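/- arXiv:1804.09850 — 5 statements merged into one kernel-verified Lean document; each statement's English description precedes it below -/
import Mathlib

section
/- For every integer k ≥ 1, every real number θ, and every real r with 0 < r ≤ 1, one has 1 − r^k·cos(kθ) ≤ k²·(1 − r·cos θ). -/
theorem abs_pow_mul_cos_le_one {r : ℝ} (hr0 : 0 ≤ r) (hr1 : r ≤ 1) (k : ℕ) (t : ℝ) :
    |r ^ k * Real.cos t| ≤ 1 := by
  rw [abs_mul, abs_of_nonneg (pow_nonneg hr0 k)]
  exact mul_le_one₀ (pow_le_one₀ hr0 hr1) (abs_nonneg _) (Real.abs_cos_le_one t)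

theorem abs_pow_mul_sin_nat_mul_le {r : ℝ} (hr0 : 0 ≤ r) (hr1 : r ≤ 1) (θ : ℝ) (k : ℕ) :
    |r ^ k * Real.sin (k * θ)| ≤ k * |r * Real.sin θ| := by
  induction k with
  | zero => simp
  | succ k ih =>
    have hx : |r * Real.cos θ| ≤ 1 := by
      simpa using abs_pow_mul_cos_le_one hr0 hr1 1 θ
    have hc := abs_pow_mul_cos_le_one hr0 hr1 k (k * θ)
    have hsplit : r ^ (k + 1) * Real.sin ((k + 1 : ℕ) * θ) =
        r ^ k * Real.sin (k * θ) * (r * Real.cos θ) +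
          r ^ k * Real.cos (k * θ) * (r * Real.sin θ) := by
      rw [Nat.cast_succ, add_one_mul, Real.sin_add]
      ring
    calc |r ^ (k + 1) * Real.sin ((k + 1 : ℕ) * θ)|
        ≤ |r ^ k * Real.sin (k * θ)| * |r * Real.cos θ| +
          |r ^ k * Real.cos (k * θ)| * |r * Real.sin θ| := by
          rw [hsplit, ← abs_mul, ← abs_mul]
          exact abs_add_le _ _
      _ ≤ |r ^ k * Real.sin (k * θ)| + |r * Real.sin θ| :=
          add_le_add (mul_le_of_le_one_right (abs_nonneg _) hx)
            (mul_le_of_le_one_left (abs_nonneg _) hc)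
      _ ≤ (k + 1 : ℕ) * |r * Real.sin θ| := by
          push_cast
          linarith

theorem one_sub_pow_mul_cos_nat_mul_le {r : ℝ} (hr0 : 0 ≤ r) (hr1 : r ≤ 1) (θ : ℝ) (k : ℕ) :
    1 - r ^ k * Real.cos (k * θ) ≤ (k : ℝ) ^ 2 * (1 - r * Real.cos θ) := by
  induction k with
  | zero => simp
  | succ k ih =>
    have hx : r * Real.cos θ ≤ 1 := by
      simpa using (abs_le.mp (abs_pow_mul_cos_le_one hr0 hr1 1 θ)).2
    have hc := (abs_le.mp (abs_pow_mul_cos_le_one hr0 hr1 k (k * θ))).2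
    have hs : r ^ k * Real.sin (k * θ) * (r * Real.sin θ) ≤ k * (r * Real.sin θ) ^ 2 := by
      calc r ^ k * Real.sin (k * θ) * (r * Real.sin θ)
          ≤ |r ^ k * Real.sin (k * θ)| * |r * Real.sin θ| := by
            rw [← abs_mul]
            exact le_abs_self _
        _ ≤ k * |r * Real.sin θ| * |r * Real.sin θ| :=
            mul_le_mul_of_nonneg_right (abs_pow_mul_sin_nat_mul_le hr0 hr1 θ k) (abs_nonneg _)
        _ = k * (r * Real.sin θ) ^ 2 := by
            rw [mul_assoc, abs_mul_abs_self, sq]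
    have hy : (r * Real.sin θ) ^ 2 ≤ 2 * (1 - r * Real.cos θ) := by
      have hxy : (r * Real.cos θ) ^ 2 + (r * Real.sin θ) ^ 2 = r ^ 2 := by
        linear_combination r ^ 2 * Real.cos_sq_add_sin_sq θ
      nlinarith [pow_le_one₀ hr0 hr1 (n := 2), sq_nonneg (1 - r * Real.cos θ)]
    have hky := mul_le_mul_of_nonneg_left hy k.cast_nonneg
    have hcx := mul_le_mul_of_nonneg_right hc (sub_nonneg.mpr hx)
    have hsplit : r ^ (k + 1) * Real.cos ((k + 1 : ℕ) * θ) =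
        r ^ k * Real.cos (k * θ) * (r * Real.cos θ) -
          r ^ k * Real.sin (k * θ) * (r * Real.sin θ) := by
      rw [Nat.cast_succ, add_one_mul, Real.cos_add]
      ring
    rw [hsplit]
    push_cast
    linarith


/-- Inequality (3.4): for every integer `k ≥ 1`, real `θ`, and real `0 < r ≤ 1`,
`1 − r^k·cos(kθ) ≤ k²·(1 − r·cos θ)`. -/
theorem stmt_4 (k : ℕ) (hk : 1 ≤ k) (θ r : ℝ) (hr0 : 0 < r) (hr1 : r ≤ 1) :
    1 - r ^ k * Real.cos (k * θ) ≤ (k : ℝ) ^ 2 * (1 - r * Real.cos θ) := by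
  exact one_sub_pow_mul_cos_nat_mul_le hr0.le hr1 θ k
end

section
/- Let κ be a complex number with Re(κ) ≥ 0. Then Re ∑_{n=1}^∞ (2/(κ+1+2n) − 1/(κ+1+n)) ≤ log 2 + (4/5)·(2 − √3); in particular this real part is at most 1. -/
open Complex

lemma re_one_div_add_natCast (κ : ℂ) (m : ℕ) :
    (1 / (κ + 1 + (m : ℂ))).re
      = (κ.re + 1 + m) / ((κ.re + 1 + m) ^ 2 + κ.im ^ 2) := by
  rw [one_div, Complex.inv_re, Complex.normSq_apply]
  simp [pow_two]

lemma sum_two_mul_even_sub (g : ℕ → ℝ) (N : ℕ) :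
    ∑ n ∈ Finset.range N, (2 * g (2 * n + 2) - g (n + 1))
      = ∑ k ∈ Finset.range N, (g (2 * k + 2) - g (2 * k + 1))
        + ∑ i ∈ Finset.range N, g (N + i + 1) := by
  have h : ∑ n ∈ Finset.range N, (2 * g (2 * n + 2) - g (n + 1))
      = ∑ k ∈ Finset.range N, (g (2 * k + 2) - g (2 * k + 1))
        + (∑ i ∈ Finset.range (2 * N), g (i + 1) - ∑ i ∈ Finset.range N, g (i + 1)) := by
    induction N with
    | zero => simp
    | succ N ih =>
      rw [Finset.sum_range_succ, ih, show 2 * (N + 1) = 2 * N + 1 + 1 by ring]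
      simp only [Finset.sum_range_succ]
      ring
  rw [h, two_mul, Finset.sum_range_add]
  ring

lemma sum_inv_le_log_two (N : ℕ) :
    ∑ i ∈ Finset.range N, (1 : ℝ) / ((N + i + 1 : ℕ) : ℝ) ≤ Real.log 2 := by
  rcases Nat.eq_zero_or_pos N with rfl | hN
  · simpa using Real.log_nonneg one_le_two
  have hN' : (0 : ℝ) < N := by exact_mod_cast hN
  calc ∑ i ∈ Finset.range N, (1 : ℝ) / ((N + i + 1 : ℕ) : ℝ)
      ≤ ∑ i ∈ Finset.range N,
          (Real.log ((N + (i + 1) : ℕ) : ℝ) - Real.log ((N + i : ℕ) : ℝ)) := by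
        refine Finset.sum_le_sum fun i _ => ?_
        have hpos : (0 : ℝ) < N + i := by positivity
        have h := Real.one_sub_inv_le_log_of_pos
          (show (0 : ℝ) < (N + i + 1) / (N + i) by positivity)
        rw [Real.log_div (by positivity) hpos.ne'] at h
        push_cast
        rw [← add_assoc]
        refine le_trans (le_of_eq ?_) h
        field_simp
        ring
    _ = Real.log 2 := by
        rw [Finset.sum_range_sub (fun i => Real.log ((N + i : ℕ) : ℝ)),
          ← Real.log_div (by positivity) (by positivity)]
        congr 1
        push_cast
        field_simp
        ring

lemma div_sq_add_sq_le_of_mul_le {a b y : ℝ} (ha : 0 < a) (hab : a ≤ b) (h : a * b ≤ y ^ 2) :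
    a / (a ^ 2 + y ^ 2) ≤ b / (b ^ 2 + y ^ 2) := by
  have hb : 0 < b := ha.trans_le hab
  rw [div_le_div_iff₀ (by positivity) (by positivity)]
  nlinarith [mul_nonneg (sub_nonneg.2 hab) (sub_nonneg.2 h)]

lemma div_sq_add_sq_le_of_le_mul {a b y : ℝ} (ha : 0 < a) (hab : a ≤ b) (h : y ^ 2 ≤ a * b) :
    b / (b ^ 2 + y ^ 2) ≤ a / (a ^ 2 + y ^ 2) := by
  have hb : 0 < b := ha.trans_le hab
  rw [div_le_div_iff₀ (by positivity) (by positivity)]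
  nlinarith [mul_nonneg (sub_nonneg.2 hab) (sub_nonneg.2 h)]

lemma monotone_div_sq_add_sq_min {y : ℝ} (hy : 0 < y) {a b : ℝ} (ha : 0 < a) (hab : a ≤ b) :
    min a y / (min a y ^ 2 + y ^ 2) ≤ min b y / (min b y ^ 2 + y ^ 2) := by
  refine div_sq_add_sq_le_of_mul_le (lt_min ha hy) (min_le_min_right y hab) ?_
  rw [pow_two]
  exact mul_le_mul (min_le_right _ _) (min_le_right _ _) (lt_min (ha.trans_le hab) hy).le hy.le

lemma div_sq_add_sq_sub_le_min {y : ℝ} (hy : 0 < y) {a b : ℝ} (ha : 0 < a) (hab : a ≤ b) :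
    b / (b ^ 2 + y ^ 2) - a / (a ^ 2 + y ^ 2)
      ≤ min b y / (min b y ^ 2 + y ^ 2) - min a y / (min a y ^ 2 + y ^ 2) := by
  rcases le_total b y with hb | hb
  · rw [min_eq_left hb, min_eq_left (hab.trans hb)]
  have hby : b / (b ^ 2 + y ^ 2) ≤ y / (y ^ 2 + y ^ 2) :=
    div_sq_add_sq_le_of_le_mul hy hb (by nlinarith)
  rcases le_total a y with hay | hay
  · rw [min_eq_right hb, min_eq_left hay]
    linarith
  · rw [min_eq_right hb, min_eq_right hay, sub_self, sub_nonpos]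
    exact div_sq_add_sq_le_of_le_mul ha hab (by nlinarith)

lemma sum_div_sq_add_sq_sub_le {x : ℝ} (hx : 1 ≤ x) (y : ℝ) (N : ℕ) :
    ∑ k ∈ Finset.range N,
      ((x + (2 * k + 2 : ℕ)) / ((x + (2 * k + 2 : ℕ)) ^ 2 + y ^ 2)
        - (x + (2 * k + 1 : ℕ)) / ((x + (2 * k + 1 : ℕ)) ^ 2 + y ^ 2)) ≤ 1 / 5 := by
  rcases eq_or_ne y 0 with rfl | hy0
  · refine (Finset.sum_nonpos fun k _ => ?_).trans (by norm_num)
    rw [sub_nonpos]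
    refine div_sq_add_sq_le_of_le_mul (by positivity) (by push_cast; linarith) ?_
    rw [zero_pow two_ne_zero]
    positivity
  rw [← sq_abs y]
  have hy : 0 < |y| := abs_pos.2 hy0
  generalize |y| = y at hy
  set h : ℝ → ℝ := fun u => min u y / (min u y ^ 2 + y ^ 2) with hh
  calc _ ≤ ∑ k ∈ Finset.range N,
        (h (x + 2 * ((k + 1 : ℕ) : ℝ) + 1) - h (x + 2 * (k : ℝ) + 1)) := by
        refine Finset.sum_le_sum fun k _ => ?_
        have h₁ := div_sq_add_sq_sub_le_min hy (a := x + (2 * k + 1 : ℕ))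
          (b := x + (2 * k + 2 : ℕ)) (by positivity) (by push_cast; linarith)
        have h₂ := monotone_div_sq_add_sq_min hy (a := x + (2 * k + 2 : ℕ))
          (b := x + 2 * ((k + 1 : ℕ) : ℝ) + 1) (by positivity) (by push_cast; linarith)
        have h₃ : x + 2 * (k : ℝ) + 1 = x + (2 * k + 1 : ℕ) := by push_cast; ring
        rw [h₃]
        simp only [hh]
        linarith
    _ = h (x + 2 * (N : ℝ) + 1) - h (x + 1) := by
        rw [Finset.sum_range_sub (fun k : ℕ => h (x + 2 * (k : ℝ) + 1))]
        simp
    _ ≤ y / (y ^ 2 + y ^ 2) - h (x + 1) := by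
        have := monotone_div_sq_add_sq_min hy (a := x + 2 * (N : ℝ) + 1)
          (b := max (x + 2 * (N : ℝ) + 1) y) (by positivity) (le_max_left _ _)
        rw [min_eq_right (le_max_right _ _)] at this
        exact sub_le_sub_right this _
    _ ≤ 1 / 5 := by
        simp only [hh]
        rcases le_total (x + 1) y with hxy | hxy
        · rw [min_eq_left hxy]
          have hd : y / (y ^ 2 + y ^ 2) = 1 / (2 * y) := by field_simp; ring
          have hu : 0 < x + 1 := by linarith
          rw [hd, div_sub_div _ _ (by positivity) (by positivity),
            div_le_div_iff₀ (by positivity) (by positivity)]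
          have h₁ : (y - (x + 1)) ^ 2 ≤ (y - 2) ^ 2 :=
            pow_le_pow_left₀ (by linarith) (by linarith) 2
          nlinarith [mul_nonneg hy.le (sq_nonneg (x + 1)), mul_nonneg hy.le (sq_nonneg (y - 3)),
            sq_nonneg (y - 4)]
        · rw [min_eq_right hxy, sub_self]
          norm_num

lemma re_sum_range_le (κ : ℂ) (hκ : 0 ≤ κ.re) (N : ℕ) :
    (∑ n ∈ Finset.range N,
      (2 / (κ + 1 + 2 * ((n : ℂ) + 1)) - 1 / (κ + 1 + ((n : ℂ) + 1)))).re
        ≤ Real.log 2 + 1 / 5 := by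
  have hterm : ∀ n : ℕ, (2 / (κ + 1 + 2 * ((n : ℂ) + 1)) - 1 / (κ + 1 + ((n : ℂ) + 1))).re
      = 2 * (1 / (κ + 1 + ((2 * n + 2 : ℕ) : ℂ))).re
        - (1 / (κ + 1 + ((n + 1 : ℕ) : ℂ))).re := by
    intro n
    have h : 2 / (κ + 1 + 2 * ((n : ℂ) + 1))
        = ((2 : ℝ) : ℂ) * (1 / (κ + 1 + ((2 * n + 2 : ℕ) : ℂ))) := by
      push_cast
      rw [mul_one_div]
      ring_nf
    rw [Complex.sub_re, h, Complex.re_ofReal_mul]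
    push_cast
    rfl
  rw [Complex.re_sum, Finset.sum_congr rfl fun n _ => hterm n,
    sum_two_mul_even_sub fun m => (1 / (κ + 1 + (m : ℂ))).re, add_comm (Real.log 2)]
  simp only [re_one_div_add_natCast]
  refine add_le_add (sum_div_sq_add_sq_sub_le (by linarith) _ N)
    ((Finset.sum_le_sum fun i _ => ?_).trans (sum_inv_le_log_two N))
  have hm : (0 : ℝ) < ((N + i + 1 : ℕ) : ℝ) := by positivity
  generalize ((N + i + 1 : ℕ) : ℝ) = m at hm
  rw [div_le_div_iff₀ (by positivity) hm]
  nlinarith [sq_nonneg κ.im, mul_nonneg hκ hm.le, mul_nonneg hκ hκ]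

lemma re_tsum_le (κ : ℂ) (hκ : 0 ≤ κ.re) :
    (∑' n : ℕ, (2 / (κ + 1 + 2 * ((n : ℂ) + 1)) - 1 / (κ + 1 + ((n : ℂ) + 1)))).re
        ≤ Real.log 2 + 1 / 5 := by
  by_cases hs : Summable fun n : ℕ =>
      (2 / (κ + 1 + 2 * ((n : ℂ) + 1)) - 1 / (κ + 1 + ((n : ℂ) + 1)))
  · exact le_of_tendsto' ((Complex.continuous_re.tendsto _).comp hs.hasSum.tendsto_sum_nat)
      (re_sum_range_le κ hκ)
  · rw [tsum_eq_zero_of_not_summable hs, Complex.zero_re]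
    have := Real.log_nonneg one_le_two
    positivity

/-- For `Re κ ≥ 0`, `Re ∑_{n≥1} (2/(κ+1+2n) − 1/(κ+1+n)) ≤ log 2 + (4/5)(2 − √3)`,
and in particular it is at most `1`. -/
theorem stmt_6 (κ : ℂ) (hκ : 0 ≤ κ.re) :
    (∑' n : ℕ, (2 / (κ + 1 + 2 * ((n : ℂ) + 1)) - 1 / (κ + 1 + ((n : ℂ) + 1)))).re
        ≤ Real.log 2 + (4 / 5) * (2 - Real.sqrt 3) ∧
    (∑' n : ℕ, (2 / (κ + 1 + 2 * ((n : ℂ) + 1)) - 1 / (κ + 1 + ((n : ℂ) + 1)))).re ≤ 1 := by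
  have h := re_tsum_le κ hκ
  have hsqrt : Real.sqrt 3 ≤ 7 / 4 := Real.sqrt_le_iff.2 (by norm_num)
  have hlog := Real.log_two_lt_d9
  constructor <;> linarith
end

section
/- Let κ be a complex number with Re(κ) ≥ 0. Then Re ∑_{n=1}^∞ (2/(κ+1+2n) − 1/(κ+1+n)) ≥ 2·log 2 − log 3. -/
open Complex

/-- Splitting the even-indexed terms off a harmonic-type sum. -/
lemma sum_two_div_sub_one_div {K : Type*} [Field K] (z : K) (N : ℕ) :
    ∑ n ∈ Finset.range N, (2 / (z + 1 + 2 * ((n : K) + 1)) - 1 / (z + 1 + ((n : K) + 1)))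
      = ∑ j ∈ Finset.range N, 1 / (z + (2 + N + j))
        - ∑ k ∈ Finset.range N, (1 / (z + (2 + 2 * k)) - 1 / (z + (3 + 2 * k))) := by
  have key : ∑ n ∈ Finset.range N, (2 / (z + 1 + 2 * ((n : K) + 1)) - 1 / (z + 1 + ((n : K) + 1)))
      = ∑ j ∈ Finset.range (N + N), 1 / (z + (2 + j)) - ∑ j ∈ Finset.range N, 1 / (z + (2 + j))
        - ∑ k ∈ Finset.range N, (1 / (z + (2 + 2 * k)) - 1 / (z + (3 + 2 * k))) := by
    induction N with
    | zero => simp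
    | succ N ih =>
      rw [show N + 1 + (N + 1) = N + N + 1 + 1 by ring]
      simp only [Finset.sum_range_succ, ih]
      push_cast
      rw [show z + 1 + 2 * ((N : K) + 1) = z + (3 + 2 * N) by ring,
        show z + 1 + ((N : K) + 1) = z + (2 + N) by ring,
        show z + (2 + ((N : K) + N)) = z + (2 + 2 * N) by ring,
        show z + (2 + ((N : K) + N + 1)) = z + (3 + 2 * N) by ring]
      ring
  rw [key, Finset.sum_range_add]
  simp [add_assoc]

lemma le_norm_add_ofReal {z : ℂ} (hz : 0 ≤ z.re) (a : ℝ) : a ≤ ‖z + a‖ := by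
  have h := re_le_norm (z + a)
  simp only [add_re, ofReal_re] at h
  linarith

lemma add_ofReal_ne_zero {z : ℂ} (hz : 0 ≤ z.re) {a : ℝ} (ha : 0 < a) : z + a ≠ 0 :=
  norm_pos_iff.mp (ha.trans_le (le_norm_add_ofReal hz a))

lemma re_one_div_add_ofReal_ge {z : ℂ} (hz : 0 ≤ z.re) {a : ℝ} (ha : 0 < a) :
    1 / a - ‖z‖ / a ^ 2 ≤ (1 / (z + a)).re := by
  have hne := add_ofReal_ne_zero hz ha
  have ha' : (a : ℂ) ≠ 0 := ofReal_ne_zero.mpr ha.ne'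
  have hdiff : ((1 / a : ℝ) : ℂ) - 1 / (z + a) = z / (a * (z + a)) := by
    push_cast
    field_simp
    ring
  have hre := re_le_norm (((1 / a : ℝ) : ℂ) - 1 / (z + a))
  have hnorm : ‖z / (a * (z + a))‖ ≤ ‖z‖ / a ^ 2 := by
    rw [norm_div, norm_mul, norm_real, Real.norm_of_nonneg ha.le, sq]
    gcongr
    exact le_norm_add_ofReal hz a
  rw [sub_re, ofReal_re, hdiff] at hre
  linarith

lemma re_one_div_sub_one_div_le {z : ℂ} (hz : 0 ≤ z.re) {a : ℝ} (ha : 0 < a) :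
    (1 / (z + a) - 1 / (z + ((a + 1 : ℝ) : ℂ))).re ≤ 1 / a - 1 / (a + 1) := by
  have hne := add_ofReal_ne_zero hz ha
  have hne' := add_ofReal_ne_zero hz (show 0 < a + 1 by linarith)
  have hdiff : 1 / (z + a) - 1 / (z + ((a + 1 : ℝ) : ℂ))
      = 1 / ((z + a) * (z + ((a + 1 : ℝ) : ℂ))) := by
    rw [div_sub_div _ _ hne hne']
    push_cast
    ring
  calc _ ≤ ‖1 / ((z + a) * (z + ((a + 1 : ℝ) : ℂ)))‖ := hdiff ▸ re_le_norm _
    _ ≤ 1 / (a * (a + 1)) := by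
      rw [norm_div, norm_mul, norm_one]
      gcongr
      · exact le_norm_add_ofReal hz a
      · exact le_norm_add_ofReal hz (a + 1)
    _ = 1 / a - 1 / (a + 1) := by
      field_simp
      ring

/-- On the right half-plane the partial sums are, up to `O(1 / N)`, at least those at `0`. -/
lemma re_sum_two_div_sub_one_div_ge {z : ℂ} (hz : 0 ≤ z.re) {N : ℕ} (hN : 0 < N) :
    ∑ n ∈ Finset.range N, (2 / (0 + 1 + 2 * ((n : ℝ) + 1)) - 1 / (0 + 1 + ((n : ℝ) + 1)))
        - ‖z‖ / N
      ≤ (∑ n ∈ Finset.range N,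
          (2 / (z + 1 + 2 * ((n : ℂ) + 1)) - 1 / (z + 1 + ((n : ℂ) + 1)))).re := by
  have hN' : (0 : ℝ) < N := Nat.cast_pos.mpr hN
  rw [sum_two_div_sub_one_div, sum_two_div_sub_one_div, sub_re, re_sum, re_sum]
  have hmain : ∑ j ∈ Finset.range N, 1 / (0 + (2 + (N : ℝ) + j)) - ‖z‖ / N
      ≤ ∑ j ∈ Finset.range N, (1 / (z + (2 + (N : ℂ) + j))).re := by
    have herr : ‖z‖ / N = ∑ _j ∈ Finset.range N, ‖z‖ / (N : ℝ) ^ 2 := by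
      rw [Finset.sum_const, Finset.card_range, nsmul_eq_mul]
      field_simp
    rw [herr, ← Finset.sum_sub_distrib]
    refine Finset.sum_le_sum fun j _ => ?_
    have h := re_one_div_add_ofReal_ge hz (show 0 < 2 + (N : ℝ) + j by positivity)
    have hle : ‖z‖ / (2 + (N : ℝ) + j) ^ 2 ≤ ‖z‖ / (N : ℝ) ^ 2 := by
      gcongr
      linarith [Nat.cast_nonneg (α := ℝ) j]
    push_cast at h
    rw [zero_add]
    linarith
  have hpairs : ∑ k ∈ Finset.range N, (1 / (z + (2 + 2 * (k : ℂ))) - 1 / (z + (3 + 2 * k))).re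
      ≤ ∑ k ∈ Finset.range N, (1 / (0 + (2 + 2 * (k : ℝ))) - 1 / (0 + (3 + 2 * k))) := by
    refine Finset.sum_le_sum fun k _ => ?_
    have h := re_one_div_sub_one_div_le hz (show 0 < 2 + 2 * (k : ℝ) by positivity)
    rw [show 2 + 2 * (k : ℝ) + 1 = 3 + 2 * k by ring] at h
    push_cast at h
    simpa only [zero_add] using h
  linarith

lemma summable_two_div_sub_one_div {z : ℂ} (hz : 0 ≤ z.re) :
    Summable fun n : ℕ => 2 / (z + 1 + 2 * ((n : ℂ) + 1)) - 1 / (z + 1 + ((n : ℂ) + 1)) := by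
  have hs : Summable fun n : ℕ => ‖z + 1‖ * (1 / ((n + 1 : ℕ) : ℝ) ^ 2) :=
    ((summable_nat_add_iff 1).mpr (Real.summable_one_div_nat_pow.mpr one_lt_two)).mul_left _
  refine Summable.of_norm_bounded hs fun n => ?_
  have ha : (0 : ℝ) < 1 + 2 * (n + 1) := by positivity
  have hb : (0 : ℝ) < 1 + (n + 1) := by positivity
  have hA := le_norm_add_ofReal hz (1 + 2 * (n + 1))
  have hB := le_norm_add_ofReal hz (1 + (n + 1))
  have hA0 := add_ofReal_ne_zero hz ha
  have hB0 := add_ofReal_ne_zero hz hb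
  push_cast [← add_assoc] at hA hB hA0 hB0 ⊢
  have hdiff : 2 / (z + 1 + 2 * ((n : ℂ) + 1)) - 1 / (z + 1 + n + 1)
      = (z + 1) / ((z + 1 + 2 * ((n : ℂ) + 1)) * (z + 1 + n + 1)) := by
    rw [div_sub_div _ _ hA0 hB0]
    ring
  rw [hdiff, norm_div, norm_mul, mul_one_div, sq]
  have hn : (0 : ℝ) ≤ n := Nat.cast_nonneg n
  gcongr <;> linarith

lemma two_mul_log_two_sub_log_three_le : 2 * Real.log 2 - Real.log 3 ≤ 29 / 100 := by
  have h : 2 * Real.log 2 - Real.log 3 = Real.log (4 / 3) := by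
    rw [Real.log_div (by norm_num) (by norm_num), show (4 : ℝ) = 2 ^ 2 by norm_num, Real.log_pow]
    norm_num
  rw [h, Real.log_le_iff_le_exp (by norm_num)]
  refine le_trans ?_ (Real.sum_le_exp_of_nonneg (show (0 : ℝ) ≤ 29 / 100 by norm_num) 4)
  norm_num [Finset.sum_range_succ, Nat.factorial]

lemma sum_two_div_sub_one_div_zero_ge {N : ℕ} (hN : 4 ≤ N) :
    (29 / 100 : ℝ) ≤ ∑ n ∈ Finset.range N,
      (2 / (0 + 1 + 2 * ((n : ℝ) + 1)) - 1 / (0 + 1 + ((n : ℝ) + 1))) := by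
  refine le_trans ?_ (Finset.sum_le_sum_of_subset_of_nonneg
    (Finset.range_subset_range.mpr hN) fun n _ _ => ?_)
  · norm_num [Finset.sum_range_succ]
  · rw [sub_nonneg, div_le_div_iff₀ (by positivity) (by positivity)]
    linarith

/-- For `Re κ ≥ 0`, `Re ∑_{n≥1} (2/(κ+1+2n) − 1/(κ+1+n)) ≥ 2·log 2 − log 3`. -/
theorem stmt_7 (κ : ℂ) (hκ : 0 ≤ κ.re) :
    2 * Real.log 2 - Real.log 3
      ≤ (∑' n : ℕ, (2 / (κ + 1 + 2 * ((n : ℂ) + 1)) - 1 / (κ + 1 + ((n : ℂ) + 1)))).re := by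
  have hsum := (continuous_re.tendsto _).comp
    (summable_two_div_sub_one_div hκ).hasSum.tendsto_sum_nat
  have herr : Filter.Tendsto (fun N : ℕ => (29 / 100 : ℝ) - ‖κ‖ / N) Filter.atTop
      (nhds (29 / 100 - 0)) :=
    tendsto_const_nhds.sub (tendsto_const_div_atTop_nhds_zero_nat ‖κ‖)
  rw [sub_zero] at herr
  refine two_mul_log_two_sub_log_three_le.trans (le_of_tendsto_of_tendsto herr hsum ?_)
  filter_upwards [Filter.eventually_ge_atTop 4] with N hN
  have h := re_sum_two_div_sub_one_div_ge hκ (show 0 < N by lia)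
  exact (sub_le_sub_right (sum_two_div_sub_one_div_zero_ge hN) _).trans h
end

section
/- For all real numbers σ ≥ 0 and t, one has (σ² + 3σ + 2 + t²)/((σ+2)² + t²) − (σ² + 4σ + 3 + t²)/((σ+3)² + t²) ≤ (4/5)·(2 − √3). -/
/-- For all real `σ ≥ 0` and `t`,
`(σ²+3σ+2+t²)/((σ+2)²+t²) − (σ²+4σ+3+t²)/((σ+3)²+t²) ≤ (4/5)(2 − √3)`. -/
theorem stmt_8 (σ t : ℝ) (hσ : 0 ≤ σ) :
    (σ ^ 2 + 3 * σ + 2 + t ^ 2) / ((σ + 2) ^ 2 + t ^ 2)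
        - (σ ^ 2 + 4 * σ + 3 + t ^ 2) / ((σ + 3) ^ 2 + t ^ 2)
      ≤ (4 / 5) * (2 - Real.sqrt 3) := by
  have hr2 : Real.sqrt 3 ^ 2 = 3 := Real.sq_sqrt (by norm_num)
  have hr : Real.sqrt 3 ≤ 7 / 4 := Real.sqrt_le_iff.mpr (by norm_num)
  have hu : 0 ≤ t ^ 2 := sq_nonneg t
  generalize Real.sqrt 3 = r at *
  generalize t ^ 2 = u at *
  obtain ⟨c, hc⟩ : ∃ c, c = (4 / 5) * (2 - r) := ⟨_, rfl⟩
  have hc5 : 1 / 5 ≤ c := by linarith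
  have hA : 0 < (σ + 2) ^ 2 + u := by positivity
  have hB : 0 < (σ + 3) ^ 2 + u := by positivity
  rw [← hc, div_sub_div _ _ hA.ne' hB.ne', div_le_iff₀ (mul_pos hA hB)]
  -- At `σ = 0` the difference of the two sides is a multiple of a perfect square in `u`.
  have hsq : c * u ^ 2 + (13 * c - 4) * u + (36 * c - 6) = c * (u - (5 * r - 3) / 2) ^ 2 := by
    rw [hc]
    linear_combination (5 * r - 16 - 4 * u) * hr2
  have h0 : 0 ≤ c * (u - (5 * r - 3) / 2) ^ 2 := mul_nonneg (by linarith) (sq_nonneg _)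
  have h1 : 0 ≤ (10 * c - 1) * (u * σ) := mul_nonneg (by linarith) (by positivity)
  have h2 : 0 ≤ 2 * c * (u * σ ^ 2) := mul_nonneg (by linarith) (by positivity)
  have h3 : 0 ≤ (60 * c - 11) * σ := mul_nonneg (by linarith) hσ
  have h4 : 0 ≤ (37 * c - 6) * σ ^ 2 := mul_nonneg (by linarith) (by positivity)
  have h5 : 0 ≤ (10 * c - 1) * σ ^ 3 := mul_nonneg (by linarith) (by positivity)
  have h6 : 0 ≤ c * σ ^ 4 := mul_nonneg (by linarith) (by positivity)
  linarith
end

section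
/- Assume the Riemann Hypothesis: every zero of the Riemann zeta function with real part strictly between 0 and 1 has real part 1/2. Let B = (1/2)·log(4π) − 1 − γ/2, where γ is the Euler–Mascheroni constant. Then for every real x > 1, |∑_{n ≤ x} (Λ(n)/n)·(1 − n/x) − (log x − (1 + γ) + log(2π)/x − ∑_{n=1}^∞ x^{−2n−1}/(2n(2n+1)))| ≤ 2|B|/√x. -/
open scoped ArithmeticFunction

section

open scoped ArithmeticFunction

open Complex ComplexConjugate

/-- The entire function `s (s - 1) π ^ (-s / 2) Γ (s / 2) ζ(s)`. -/
noncomputable def riemannXi (s : ℂ) : ℂ := s * (s - 1) * completedRiemannZeta₀ s + 1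

namespace riemannXi

theorem differentiable : Differentiable ℂ riemannXi := by
  unfold riemannXi
  have := differentiable_completedZeta₀
  fun_prop

theorem one_sub (s : ℂ) : riemannXi (1 - s) = riemannXi s := by
  simp only [riemannXi, completedRiemannZeta₀_one_sub]
  ring

theorem apply_one : riemannXi 1 = 1 := by simp [riemannXi]

theorem eq_completedRiemannZeta {s : ℂ} (h0 : s ≠ 0) (h1 : s ≠ 1) :
    riemannXi s = s * (s - 1) * completedRiemannZeta s := by
  have h1' : 1 - s ≠ 0 := sub_ne_zero.mpr h1.symm
  rw [riemannXi, completedRiemannZeta_eq]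
  field_simp
  ring

theorem eq_riemannZeta {s : ℂ} (hs : 0 < s.re) (h1 : s ≠ 1) :
    riemannXi s = s * (s - 1) * Gammaℝ s * riemannZeta s := by
  have h0 : s ≠ 0 := by rintro rfl; simp at hs
  rw [eq_completedRiemannZeta h0 h1, riemannZeta_def_of_ne_zero h0]
  have := Gammaℝ_ne_zero_of_re_pos hs
  field_simp

theorem hasDerivAt_one : HasDerivAt riemannXi (completedRiemannZeta₀ 1) 1 := by
  have h : HasDerivAt (fun s : ℂ => s * (s - 1)) 1 1 := by
    simpa using (hasDerivAt_id' (1 : ℂ)).fun_mul ((hasDerivAt_id' (1 : ℂ)).sub_const 1)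
  have h2 := (h.fun_mul (differentiable_completedZeta₀ 1).hasDerivAt).add_const 1
  simp only [one_mul, sub_self, mul_zero, zero_mul, add_zero] at h2
  exact h2

theorem Gammaℝ_conj (s : ℂ) : Gammaℝ (conj s) = conj (Gammaℝ s) := by
  have hpi : conj ((Real.pi : ℂ) ^ (-s / 2)) = (Real.pi : ℂ) ^ conj (-s / 2) := by
    rw [cpow_conj _ _ (by simp [arg_ofReal_of_nonneg Real.pi_pos.le, Real.pi_ne_zero.symm]),
      conj_ofReal]
  rw [Gammaℝ_def, Gammaℝ_def, map_mul, ← Gamma_conj, hpi]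
  simp only [map_div₀, map_neg, map_ofNat]

theorem apply_conj (s : ℂ) : riemannXi (conj s) = conj (riemannXi s) := by
  have key : ∀ s : ℂ, 0 < s.re → riemannXi (conj s) = conj (riemannXi s) := by
    intro s hs
    rcases eq_or_ne s 1 with rfl | h1
    · simp [apply_one]
    · rw [eq_riemannZeta hs h1, eq_riemannZeta (by simpa using hs)
        (fun h => h1 (by simpa using congrArg conj h)),
        Gammaℝ_conj, riemannZeta_conj]
      simp
  rcases lt_or_ge 0 s.re with hs | hs
  · exact key s hs
  · have := key (1 - s) (by simp; linarith)
    rwa [one_sub, map_sub, map_one, one_sub] at this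

theorem norm_reflect (z : ℂ) : ‖riemannXi (1 / 2 + z)‖ = ‖riemannXi (1 / 2 - conj z)‖ := by
  rw [← one_sub, ← norm_conj, ← apply_conj]
  congr 2
  simp only [map_sub, map_add, map_div₀, map_one, map_ofNat]
  ring

theorem ne_zero
    (RH : ∀ s : ℂ, riemannZeta s = 0 → 0 < s.re → s.re < 1 → s.re = 1 / 2)
    {s : ℂ} (hs : 1 / 2 < s.re) : riemannXi s ≠ 0 := by
  rcases eq_or_ne s 1 with rfl | h1
  · simp [apply_one]
  have h0 : s ≠ 0 := by rintro rfl; norm_num at hs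
  rw [eq_riemannZeta (by linarith) h1]
  refine mul_ne_zero (mul_ne_zero (mul_ne_zero h0 (sub_ne_zero.mpr h1))
    (Gammaℝ_ne_zero_of_re_pos (by linarith))) fun hz => ?_
  rcases lt_or_ge s.re 1 with h | h
  · linarith [RH s hz (by linarith) h]
  · exact riemannZeta_ne_zero_of_one_le_re h hz

end riemannXi

end

section

open Complex ComplexConjugate MeasureTheory Set

theorem exists_bound_mellin_of_mem_strip {f : ℝ → ℂ} {a b : ℝ}
    (ha : MellinConvergent f a) (hb : MellinConvergent f b) :
    ∃ C, ∀ s : ℂ, a ≤ s.re → s.re ≤ b → ‖mellin f s‖ ≤ C := by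
  refine ⟨∫ t in Ioi (0 : ℝ), (‖(t : ℂ) ^ ((a : ℂ) - 1) • f t‖ + ‖(t : ℂ) ^ ((b : ℂ) - 1) • f t‖),
    fun s has hsb => ?_⟩
  refine norm_integral_le_of_norm_le (ha.norm.add hb.norm) ?_
  refine (ae_restrict_iff' measurableSet_Ioi).mpr (Filter.Eventually.of_forall fun t ht => ?_)
  rw [mem_Ioi] at ht
  simp only [norm_smul, norm_cpow_eq_rpow_re_of_pos ht, ← add_mul]
  refine mul_le_mul_of_nonneg_right ?_ (norm_nonneg _)
  simp only [sub_re, ofReal_re, one_re]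
  have h1 := (Real.rpow_pos_of_pos ht (a - 1)).le
  have h2 := (Real.rpow_pos_of_pos ht (b - 1)).le
  rcases le_total t 1 with h | h
  · have := Real.rpow_le_rpow_of_exponent_ge ht h (by linarith : a - 1 ≤ s.re - 1)
    linarith
  · have := Real.rpow_le_rpow_of_exponent_le h (by linarith : s.re - 1 ≤ b - 1)
    linarith

theorem exists_bound_completedRiemannZeta₀ (a b : ℝ) :
    ∃ C, ∀ s : ℂ, a ≤ s.re → s.re ≤ b → ‖completedRiemannZeta₀ s‖ ≤ C := by
  obtain ⟨C, hC⟩ := exists_bound_mellin_of_mem_strip (a := a / 2) (b := b / 2)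
    ((HurwitzZeta.hurwitzEvenFEPair 0).isStrongFEPair_toStrongFEPair.hasMellin _).1
    ((HurwitzZeta.hurwitzEvenFEPair 0).isStrongFEPair_toStrongFEPair.hasMellin _).1
  refine ⟨C / 2, fun s h1 h2 => ?_⟩
  have hre : (s / 2).re = s.re / 2 := by simp
  have := hC (s / 2) (by rw [hre]; linarith) (by rw [hre]; linarith)
  rw [show completedRiemannZeta₀ s = (HurwitzZeta.hurwitzEvenFEPair 0).Λ₀ (s / 2) / 2 from rfl,
    norm_div, Complex.norm_ofNat]
  exact div_le_div_of_nonneg_right this (by norm_num)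

theorem riemannXi.exists_bound (a b : ℝ) :
    ∃ C, 0 < C ∧ ∀ s : ℂ, a ≤ s.re → s.re ≤ b → ‖riemannXi s‖ ≤ C * (1 + ‖s‖) ^ 2 := by
  obtain ⟨C, hC⟩ := exists_bound_completedRiemannZeta₀ a b
  refine ⟨|C| + 1, by positivity, fun s h1 h2 => ?_⟩
  have h := (hC s h1 h2).trans (le_abs_self C)
  have h3 : ‖s - 1‖ ≤ 1 + ‖s‖ := (norm_sub_le _ _).trans (by simp [add_comm])
  calc ‖riemannXi s‖ ≤ ‖s‖ * ‖s - 1‖ * ‖completedRiemannZeta₀ s‖ + 1 := by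
        unfold riemannXi
        exact (norm_add_le _ _).trans (by simp)
    _ ≤ (1 + ‖s‖) * (1 + ‖s‖) * |C| + (1 + ‖s‖) * (1 + ‖s‖) := by
        have := norm_nonneg s
        gcongr
        · linarith
        · nlinarith
    _ = _ := by ring

theorem Complex.norm_sin_le_exp_abs_im (z : ℂ) : ‖sin z‖ ≤ Real.exp |z.im| := by
  rw [sin, norm_div, norm_mul, norm_I, mul_one, Complex.norm_ofNat, div_le_iff₀ two_pos]
  refine (norm_sub_le _ _).trans ?_
  rw [norm_exp, norm_exp]
  have h1 : Real.exp (-z * I).re ≤ Real.exp |z.im| := by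
    apply Real.exp_le_exp.mpr; simpa using le_abs_self _
  have h2 : Real.exp (z * I).re ≤ Real.exp |z.im| := by
    apply Real.exp_le_exp.mpr; simpa using neg_le_abs _
  linarith

theorem Complex.norm_Gamma_le_Gamma_re {s : ℂ} (hs : 0 < s.re) : ‖Gamma s‖ ≤ Real.Gamma s.re := by
  rw [Gamma_eq_integral hs, Real.Gamma_eq_integral hs, GammaIntegral]
  refine (norm_integral_le_integral_norm _).trans (le_of_eq ?_)
  refine setIntegral_congr_fun measurableSet_Ioi fun t ht => ?_
  rw [mem_Ioi] at ht
  simp only [norm_mul, norm_cpow_eq_rpow_re_of_pos ht, sub_re, one_re, norm_real, Real.norm_eq_abs,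
    Real.abs_exp]

theorem Complex.inv_norm_Gamma_le {s : ℂ} (hs : 0 < s.re) (hs1 : s.re < 1) :
    ‖Gamma s‖⁻¹ ≤ Real.Gamma (1 - s.re) * Real.exp (Real.pi * |s.im|) / Real.pi := by
  have hG := Gamma_ne_zero_of_re_pos hs
  have hG' : Gamma (1 - s) ≠ 0 := Gamma_ne_zero_of_re_pos (by simpa using hs1)
  have h := Gamma_mul_Gamma_one_sub s
  have hsin : sin (Real.pi * s) ≠ 0 := fun h0 => by
    rw [h0, div_zero] at h
    exact mul_ne_zero hG hG' h
  have hinv : (Gamma s)⁻¹ = Gamma (1 - s) * sin (Real.pi * s) / Real.pi := by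
    have : (Real.pi : ℂ) ≠ 0 := by exact_mod_cast Real.pi_ne_zero
    rw [eq_div_iff hsin] at h
    apply inv_eq_of_mul_eq_one_right
    rw [mul_div_assoc', ← mul_assoc, h, div_self this]
  rw [← norm_inv, hinv, norm_div, norm_mul, norm_real, Real.norm_eq_abs, abs_of_pos Real.pi_pos]
  have h1 : ‖Gamma (1 - s)‖ ≤ Real.Gamma (1 - s.re) := by
    simpa using norm_Gamma_le_Gamma_re (s := 1 - s) (by simpa using hs1)
  have h2 : ‖sin (Real.pi * s)‖ ≤ Real.exp (Real.pi * |s.im|) := by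
    simpa [abs_mul, abs_of_pos Real.pi_pos] using norm_sin_le_exp_abs_im (Real.pi * s)
  gcongr

theorem norm_LSeries_le_of_re_ge {f : ℕ → ℂ} {σ : ℝ} (hf : LSeriesSummable f σ) {s : ℂ}
    (hs : σ ≤ s.re) : ‖LSeries f s‖ ≤ ∑' n, ‖LSeries.term f σ n‖ := by
  have hs' : LSeriesSummable f s := hf.of_re_le_re (by simpa using hs)
  refine (norm_tsum_le_tsum_norm hs'.norm).trans ?_
  exact hs'.norm.tsum_le_tsum (fun n => LSeries.norm_term_le_of_re_le_re f (by simpa using hs) n)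
    hf.norm

theorem exists_bound_riemannZeta {σ : ℝ} (hσ : 1 < σ) :
    ∃ C, 0 < C ∧ ∀ s : ℂ, σ ≤ s.re →
      ‖riemannZeta s‖ ≤ C ∧ ‖riemannZeta s‖⁻¹ ≤ C ∧
      ‖deriv riemannZeta s / riemannZeta s‖ ≤ C := by
  have hσ' : 1 < (σ : ℂ).re := by simpa
  refine ⟨1 + (∑' n, ‖LSeries.term 1 σ n‖) +
    (∑' n, ‖LSeries.term (fun n => ((ArithmeticFunction.moebius n : ℤ) : ℂ)) σ n‖) +
    (∑' n, ‖LSeries.term (fun n => (Λ n : ℂ)) σ n‖), by positivity, fun s hs => ?_⟩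
  have hs1 : 1 < s.re := by linarith
  have t1 : 0 ≤ ∑' n, ‖LSeries.term 1 σ n‖ := tsum_nonneg fun _ => norm_nonneg _
  have t2 : 0 ≤ ∑' n, ‖LSeries.term (fun n => ((ArithmeticFunction.moebius n : ℤ) : ℂ)) σ n‖ :=
    tsum_nonneg fun _ => norm_nonneg _
  have t3 : 0 ≤ ∑' n, ‖LSeries.term (fun n => (Λ n : ℂ)) σ n‖ := tsum_nonneg fun _ => norm_nonneg _
  have h1 := norm_LSeries_le_of_re_ge (LSeriesSummable_one_iff.mpr hσ') hs
  have h2 := norm_LSeries_le_of_re_ge (ArithmeticFunction.LSeriesSummable_moebius_iff.mpr hσ') hs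
  have h3 := norm_LSeries_le_of_re_ge
    (ArithmeticFunction.LSeriesSummable_vonMangoldt hσ') hs
  rw [LSeries_one_eq_riemannZeta hs1] at h1
  have hinv := LSeries_one_mul_Lseries_moebius hs1
  rw [LSeries_one_eq_riemannZeta hs1] at hinv
  rw [eq_inv_of_mul_eq_one_right hinv, norm_inv] at h2
  rw [ArithmeticFunction.LSeries_vonMangoldt_eq_deriv_riemannZeta_div hs1, neg_div, norm_neg] at h3
  exact ⟨by linarith, by linarith, by linarith⟩

theorem exp_neg_le_norm_of_ne_zero_of_norm_le {f : ℂ → ℂ} {R M : ℝ} (hM : 0 < M) (hR : 0 < R)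
    (hf : DifferentiableOn ℂ f (Metric.ball 0 R)) (h0 : ∀ z ∈ Metric.ball 0 R, f z ≠ 0)
    (hf0 : f 0 = 1) (hb : ∀ z ∈ Metric.ball 0 R, ‖f z‖ ≤ Real.exp M) {z : ℂ}
    (hz : z ∈ Metric.ball 0 R) : Real.exp (-(2 * M * ‖z‖ / (R - ‖z‖))) ≤ ‖f z‖ := by
  have hd : DifferentiableOn ℂ (fun z => deriv f z / f z) (Metric.ball 0 R) :=
    (hf.deriv Metric.isOpen_ball).div hf h0
  obtain ⟨g, hg0, hg⟩ := hd.isExactOn_ball.with_val_at 0 0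
  have hfg : ∀ z ∈ Metric.ball (0 : ℂ) R, f z = exp (g z) := by
    intro z hz
    have hder : ∀ w ∈ Metric.ball (0 : ℂ) R, HasDerivAt (fun w => f w * exp (-g w)) 0 w := by
      intro w hw
      have h1 := (hf.differentiableAt (Metric.isOpen_ball.mem_nhds hw)).hasDerivAt
      refine (h1.fun_mul (hg w hw).fun_neg.cexp).congr_deriv ?_
      have := mul_div_cancel₀ (deriv f w) (h0 w hw)
      linear_combination -(exp (-g w)) * this
    have hconst := Metric.isOpen_ball.is_const_of_deriv_eq_zero
      (convex_ball (0 : ℂ) R).isPreconnected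
      (fun w hw => (hder w hw).differentiableAt.differentiableWithinAt)
      (fun w hw => (hder w hw).deriv) hz (Metric.mem_ball_self hR)
    simp only [hf0, hg0, neg_zero, exp_zero, mul_one] at hconst
    rw [exp_neg] at hconst
    rwa [mul_inv_eq_one₀ (exp_ne_zero _)] at hconst
  have hgM : MapsTo g (Metric.ball 0 R) {z | z.re ≤ M} := by
    intro w hw
    have := hb w hw
    rwa [hfg w hw, norm_exp, Real.exp_le_exp] at this
  have hB := borelCaratheodory_zero hM
    (fun w hw => (hg w hw).differentiableAt.differentiableWithinAt) hgM hR hz hg0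
  rw [hfg z hz, norm_exp, Real.exp_le_exp]
  linarith [neg_le_of_abs_le (abs_re_le_norm (g z))]

theorem riemannXi.exists_lower_bound_three_halves :
    ∃ K, 0 < K ∧ ∀ s : ℂ, s.re = 3 / 2 → ‖riemannXi s‖⁻¹ ≤ Real.exp (K * (1 + |s.im|)) := by
  obtain ⟨C, hC0, hC⟩ := exists_bound_riemannZeta (σ := 3 / 2) (by norm_num)
  have hG : 0 < Real.Gamma (1 / 4) := Real.Gamma_pos_of_pos (by norm_num)
  have hpi := Real.pi_pos
  have hpi' : 0 < Real.pi ^ (3 / 4 : ℝ) := Real.rpow_pos_of_pos hpi _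
  set D := (4 / 3) * (Real.pi ^ (3 / 4 : ℝ)) * (Real.Gamma (1 / 4) / Real.pi) * C with hD
  refine ⟨D + Real.pi, by positivity, fun s hs => ?_⟩
  have hs1 : s ≠ 1 := by rintro rfl; norm_num at hs
  rw [eq_riemannZeta (by linarith) hs1, Gammaℝ_def]
  simp only [norm_mul, mul_inv, norm_cpow_eq_rpow_re_of_pos hpi]
  have hre2 : (s / 2).re = 3 / 4 := by simp [hs]; norm_num
  have him2 : (s / 2).im = s.im / 2 := by simp
  have hren : (-s / 2).re = -(3 / 4) := by simp [hs]; norm_num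
  have e1 : ‖s‖⁻¹ ≤ 2 / 3 := by
    rw [inv_le_comm₀ (norm_pos_iff.mpr (by rintro rfl; norm_num at hs)) (by norm_num)]
    have := abs_re_le_norm s
    rw [hs, abs_of_pos (by norm_num)] at this
    linarith
  have e2 : ‖s - 1‖⁻¹ ≤ 2 := by
    rw [inv_le_comm₀ (norm_pos_iff.mpr (sub_ne_zero.mpr hs1)) (by norm_num)]
    have := abs_re_le_norm (s - 1)
    rw [sub_re, hs, one_re] at this
    norm_num [abs_of_pos] at this ⊢
    linarith
  have e3 : (Real.pi ^ (-s / 2).re)⁻¹ = Real.pi ^ (3 / 4 : ℝ) := by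
    rw [hren, Real.rpow_neg hpi.le, inv_inv]
  have e4 := inv_norm_Gamma_le (s := s / 2) (by rw [hre2]; norm_num) (by rw [hre2]; norm_num)
  rw [hre2, him2, abs_div, abs_two, show (1 - 3 / 4 : ℝ) = 1 / 4 by norm_num] at e4
  have e4' : ‖Gamma (s / 2)‖⁻¹ ≤ Real.Gamma (1 / 4) / Real.pi * Real.exp (Real.pi * |s.im|) := by
    refine e4.trans ?_
    rw [mul_div_right_comm]
    have : Real.pi * (|s.im| / 2) ≤ Real.pi * |s.im| := by
      have := abs_nonneg s.im
      gcongr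
      linarith
    gcongr
  rw [e3]
  calc _ ≤ (2 / 3) * 2 * (Real.pi ^ (3 / 4 : ℝ) *
        (Real.Gamma (1 / 4) / Real.pi * Real.exp (Real.pi * |s.im|))) * C := by
        gcongr
        exact (hC s hs.ge).2.1
    _ = D * Real.exp (Real.pi * |s.im|) := by rw [hD]; ring
    _ ≤ Real.exp D * Real.exp (Real.pi * |s.im|) := by
        gcongr
        linarith [Real.add_one_le_exp D]
    _ = Real.exp (D + Real.pi * |s.im|) := (Real.exp_add _ _).symm
    _ ≤ _ := by
        apply Real.exp_le_exp.mpr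
        have : 0 ≤ D * |s.im| := by positivity
        nlinarith

theorem riemannXi.exists_lower_bound
    (RH : ∀ s : ℂ, riemannZeta s = 0 → 0 < s.re → s.re < 1 → s.re = 1 / 2)
    {h : ℝ} (hh : 0 < h) (hh1 : h < 1) :
    ∃ K, 0 < K ∧ ∀ s : ℂ, 1 / 2 + h ≤ s.re → s.re ≤ 3 / 2 →
      ‖riemannXi s‖⁻¹ ≤ Real.exp (K * (1 + |s.im|)) := by
  obtain ⟨K, hK0, hK⟩ := exists_lower_bound_three_halves
  obtain ⟨C, hC0, hC⟩ := exists_bound (1 / 2) (5 / 2)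
  set A := 2 * (C + 9) + K with hA
  have hA0 : 0 < A := by positivity
  refine ⟨2 * A / h + K, by positivity, fun s hs1 hs2 => ?_⟩
  set w : ℂ := ⟨3 / 2, s.im⟩ with hw
  set y := 1 + |s.im| with hy
  have hy1 : 1 ≤ y := by have := abs_nonneg s.im; linarith
  have hw0 : riemannXi w ≠ 0 := ne_zero RH (by norm_num [hw])
  have hKw := hK w rfl
  have hmem : ∀ z ∈ Metric.ball (0 : ℂ) 1, 1 / 2 < (w + z).re ∧ (w + z).re < 5 / 2 := by
    intro z hz
    have hz' := mem_ball_zero_iff.mp hz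
    have h1 := abs_le.mp (abs_re_le_norm z)
    simp only [add_re, hw]
    constructor <;> linarith
  have hnw : ‖w‖ ≤ 3 / 2 + |s.im| := by
    refine (norm_le_abs_re_add_abs_im w).trans ?_
    norm_num [hw, abs_of_pos]
  have hsw : s = w + (s - w) := by ring
  have hd1 : ‖s - w‖ = 3 / 2 - s.re := by
    have : s - w = ((s.re - 3 / 2 : ℝ) : ℂ) := by
      apply Complex.ext <;> simp [hw]
    rw [this, norm_real, Real.norm_eq_abs, abs_of_nonpos (by linarith)]
    ring
  have hball : s - w ∈ Metric.ball (0 : ℂ) 1 := by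
    rw [mem_ball_zero_iff, hd1]; linarith
  have hpow : ∀ n : ℝ, 0 ≤ n → n ≤ Real.exp n := fun n _ => by linarith [Real.add_one_le_exp n]
  have key := exp_neg_le_norm_of_ne_zero_of_norm_le (f := fun z => riemannXi (w + z) / riemannXi w)
    (R := 1) (M := A * y) (by positivity) one_pos
    (by have := differentiable; fun_prop)
    (fun z hz => div_ne_zero (ne_zero RH (hmem z hz).1) hw0) (by simp [hw0]) ?_ hball
  · simp only [← hsw, norm_div, hd1] at key
    have hx0 : 0 < ‖riemannXi s‖ := norm_pos_iff.mpr (ne_zero RH (by linarith))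
    have hxw : 0 < ‖riemannXi w‖ := norm_pos_iff.mpr hw0
    have hle : 2 * (A * y) * (3 / 2 - s.re) / (1 - (3 / 2 - s.re)) ≤ 2 * A / h * y := by
      rw [div_le_iff₀ (by linarith)]
      have h1 : 2 * A / h * y * (1 - (3 / 2 - s.re)) ≥ 2 * A / h * y * h := by
        gcongr; linarith
      have h2 : 2 * A / h * y * h = 2 * (A * y) := by field_simp
      have h3 : 2 * (A * y) * (3 / 2 - s.re) ≤ 2 * (A * y) * 1 := by
        gcongr; linarith
      linarith
    have h4 : Real.exp (-(2 * A / h * y)) ≤ ‖riemannXi s‖ / ‖riemannXi w‖ :=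
      (Real.exp_le_exp.mpr (neg_le_neg hle)).trans key
    have h5 : ‖riemannXi s‖⁻¹ ≤ Real.exp (2 * A / h * y) * ‖riemannXi w‖⁻¹ := by
      rw [Real.exp_neg, inv_le_comm₀ (Real.exp_pos _) (by positivity), inv_div] at h4
      rw [← div_eq_mul_inv, le_div_iff₀ hxw, mul_comm, ← div_eq_mul_inv]
      exact h4
    refine h5.trans ((mul_le_mul_of_nonneg_left hKw (Real.exp_pos _).le).trans ?_)
    rw [← Real.exp_add, add_mul]
  · intro z hz
    have hz' := mem_ball_zero_iff.mp hz
    rw [norm_div, div_eq_mul_inv]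
    have h1 := hC (w + z) (hmem z hz).1.le (hmem z hz).2.le
    have h2 : 1 + ‖w + z‖ ≤ 4 * y := by
      have := norm_add_le w z
      have := abs_nonneg s.im
      linarith
    have h3 : ‖riemannXi (w + z)‖ ≤ Real.exp (2 * (C + 9) * y) := by
      refine h1.trans ?_
      have e1 : C ≤ Real.exp C := hpow C hC0.le
      have e2 : 1 + ‖w + z‖ ≤ Real.exp (4 * y) := h2.trans (hpow _ (by positivity))
      calc C * (1 + ‖w + z‖) ^ 2 ≤ Real.exp C * (Real.exp (4 * y)) ^ 2 := by gcongr
        _ = Real.exp (C + 2 * (4 * y)) := by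
          rw [← Real.exp_nat_mul, ← Real.exp_add]; norm_num
        _ ≤ _ := by
          apply Real.exp_le_exp.mpr
          nlinarith
    calc _ ≤ Real.exp (2 * (C + 9) * y) * Real.exp (K * y) := by gcongr
      _ = _ := by rw [← Real.exp_add]; congr 1; rw [hA]; ring

end

section

open Complex ComplexConjugate MeasureTheory Set Filter

theorem Complex.exists_bound_Gamma_add_ofReal {a h : ℝ} (ha : 0 < a) (hh : 0 < h) :
    ∃ C, 0 < C ∧ ∀ s : ℂ, a ≤ s.re → ‖Gamma s‖ ≤ C * ‖Gamma (s + h)‖ := by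
  have hG : 0 < Real.Gamma h := Real.Gamma_pos_of_pos hh
  have hconv := (betaIntegral_convergent (u := a) (v := h) (by simpa) (by simpa)).norm
  set I := ∫ x in (0 : ℝ)..1, ‖(x : ℂ) ^ ((a : ℂ) - 1) * (1 - x) ^ ((h : ℂ) - 1)‖ with hI
  have hI0 : 0 ≤ I := intervalIntegral.integral_nonneg zero_le_one fun _ _ => norm_nonneg _
  refine ⟨I / Real.Gamma h + 1, by positivity, fun s hs => ?_⟩
  have hs0 : 0 < s.re := by linarith
  have hb := Gamma_mul_Gamma_eq_betaIntegral (s := s) (t := h) hs0 (by simpa)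
  have hbI : ‖betaIntegral s h‖ ≤ I := by
    refine (intervalIntegral.norm_integral_le_integral_norm zero_le_one).trans ?_
    refine intervalIntegral.integral_mono_on_of_le_Ioo zero_le_one
      (betaIntegral_convergent hs0 (by simpa)).norm hconv fun x hx => ?_
    rw [norm_mul, norm_mul]
    gcongr
    rw [norm_cpow_eq_rpow_re_of_pos hx.1, norm_cpow_eq_rpow_re_of_pos hx.1]
    exact Real.rpow_le_rpow_of_exponent_ge hx.1 hx.2.le (by simpa)
  have h1 : ‖Gamma s‖ * Real.Gamma h = ‖Gamma (s + h)‖ * ‖betaIntegral s h‖ := by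
    rw [← norm_mul, ← hb, norm_mul, Gamma_ofReal, norm_real, Real.norm_eq_abs, abs_of_pos hG]
  have h2 : ‖Gamma s‖ = ‖betaIntegral s h‖ / Real.Gamma h * ‖Gamma (s + h)‖ := by
    field_simp
    linarith
  rw [h2]
  gcongr
  have : ‖betaIntegral s h‖ / Real.Gamma h ≤ I / Real.Gamma h := by gcongr
  linarith

theorem Complex.norm_le_norm_add_ofReal {s : ℂ} {h : ℝ} (hs : 0 ≤ s.re) (hh : 0 ≤ h) :
    ‖s‖ ≤ ‖s + h‖ := by
  rw [norm_def, norm_def]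
  apply Real.sqrt_le_sqrt
  simp only [normSq_apply, add_re, ofReal_re, add_im, ofReal_im, add_zero]
  nlinarith

theorem riemannXi.exists_bound_add_ofReal {h : ℝ} (hh : 0 < h) :
    ∃ C, 0 < C ∧ ∀ s : ℂ, 5 / 4 ≤ s.re → ‖riemannXi s‖ ≤ C * ‖riemannXi (s + h)‖ := by
  obtain ⟨C, hC0, hC⟩ := exists_bound_riemannZeta (σ := 5 / 4) (by norm_num)
  obtain ⟨D, hD0, hD⟩ := exists_bound_Gamma_add_ofReal (a := 5 / 8) (h := h / 2)
    (by norm_num) (by positivity)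
  have hpi := Real.pi_pos
  refine ⟨Real.pi ^ (h / 2) * D * (C * C), by positivity, fun s hs => ?_⟩
  have hsh : 5 / 4 ≤ (s + h).re := by simp; linarith
  have hs1 : s ≠ 1 := by rintro rfl; norm_num at hs
  have hsh1 : s + h ≠ 1 := by intro h0; rw [h0] at hsh; norm_num at hsh
  rw [eq_riemannZeta (by linarith) hs1, eq_riemannZeta (by linarith) hsh1, Gammaℝ_def, Gammaℝ_def]
  simp only [norm_mul, norm_cpow_eq_rpow_re_of_pos hpi]
  have e1 := norm_le_norm_add_ofReal (s := s) (h := h) (by linarith) hh.le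
  have e2 : ‖s - 1‖ ≤ ‖s + h - 1‖ := by
    have := norm_le_norm_add_ofReal (s := s - 1) (h := h) (by simp; linarith) hh.le
    rwa [sub_add_eq_add_sub] at this
  have e3 : Real.pi ^ (-s / 2).re = Real.pi ^ (h / 2) * Real.pi ^ (-(s + h) / 2).re := by
    rw [← Real.rpow_add hpi]
    congr 1
    simp
    ring
  have e4 : ‖Gamma (s / 2)‖ ≤ D * ‖Gamma ((s + h) / 2)‖ := by
    have := hD (s / 2) (by simp; linarith)
    convert this using 4
    push_cast
    ring
  have e5 : ‖riemannZeta s‖ ≤ C * C * ‖riemannZeta (s + h)‖ := by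
    have h1 := (hC s hs).1
    have h2 := (hC _ hsh).2.1
    have h3 : 0 < ‖riemannZeta (s + h)‖ :=
      norm_pos_iff.mpr (riemannZeta_ne_zero_of_one_le_re (by linarith))
    rw [inv_le_iff_one_le_mul₀ h3] at h2
    nlinarith
  rw [e3]
  calc _ ≤ ‖s + h‖ * ‖s + h - 1‖ * (Real.pi ^ (h / 2) * Real.pi ^ (-(s + h) / 2).re *
        (D * ‖Gamma ((s + h) / 2)‖)) * (C * C * ‖riemannZeta (s + h)‖) := by gcongr
    _ = _ := by ring

end

section

open Complex ComplexConjugate MeasureTheory Set Filter Topology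

theorem riemannXi.norm_sub_le_norm_add
    (RH : ∀ s : ℂ, riemannZeta s = 0 → 0 < s.re → s.re < 1 → s.re = 1 / 2)
    {h : ℝ} (hh : 0 < h) (hh8 : h ≤ 1 / 8) {z : ℂ} (hz : 0 ≤ z.re) :
    ‖riemannXi (1 / 2 + z - h)‖ ≤ ‖riemannXi (1 / 2 + z + h)‖ := by
  obtain ⟨K, hK0, hK⟩ := exists_lower_bound RH hh (by linarith)
  obtain ⟨C, hC0, hC⟩ := exists_bound 0 (3 / 2)
  obtain ⟨D, hD0, hD⟩ := exists_bound_add_ofReal (h := 2 * h) (by positivity)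
  have hne : ∀ z : ℂ, 0 ≤ z.re → riemannXi (1 / 2 + z + h) ≠ 0 := fun z hz =>
    ne_zero RH (by norm_num; linarith)
  have hfar : ∀ z : ℂ, 7 / 8 ≤ z.re →
      ‖riemannXi (1 / 2 + z - h) / riemannXi (1 / 2 + z + h)‖ ≤ D := by
    intro z hz
    rw [norm_div, div_le_iff₀ (norm_pos_iff.mpr (hne z (by linarith)))]
    have h1 := hD (1 / 2 + z - h) (by norm_num; linarith)
    rwa [show 1 / 2 + z - h + (2 * h : ℝ) = 1 / 2 + z + h by push_cast; ring] at h1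
  have hnear : ∀ z : ℂ, 0 < z.re → z.re ≤ 7 / 8 →
      ‖riemannXi (1 / 2 + z - h) / riemannXi (1 / 2 + z + h)‖ ≤
        4 * C * Real.exp K * Real.exp ((K + 2) * ‖z‖) := by
    intro z hz hz'
    rw [norm_div, div_eq_mul_inv]
    have h1 := hK (1 / 2 + z + h) (by norm_num; linarith) (by norm_num; linarith)
    have h2 := hC (1 / 2 + z - h) (by norm_num; linarith) (by norm_num; linarith)
    have h3 : 1 + ‖1 / 2 + z - h‖ ≤ 2 * Real.exp ‖z‖ := by
      have : ‖1 / 2 + z - h‖ ≤ ‖((1 / 2 - h : ℝ) : ℂ)‖ + ‖z‖ := by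
        refine le_trans (le_of_eq ?_) (norm_add_le _ _)
        congr 1
        push_cast
        ring
      rw [norm_real, Real.norm_eq_abs, abs_of_nonneg (by linarith)] at this
      have := Real.add_one_le_exp ‖z‖
      have := norm_nonneg z
      linarith
    have h4 : |(1 / 2 + z + h).im| ≤ ‖z‖ := by simpa using abs_im_le_norm z
    calc _ ≤ (C * (2 * Real.exp ‖z‖) ^ 2) * Real.exp (K * (1 + ‖z‖)) := by
          gcongr
          · exact h2.trans (by gcongr)
          · exact h1.trans (by gcongr)
      _ = 4 * C * (Real.exp (2 * ‖z‖) * Real.exp (K * (1 + ‖z‖))) := by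
          rw [show 2 * ‖z‖ = ‖z‖ + ‖z‖ by ring, Real.exp_add]; ring
      _ = _ := by rw [← Real.exp_add, mul_assoc _ (Real.exp K), ← Real.exp_add]; congr 2; ring
  have hdiff : DifferentiableOn ℂ
      (fun z => riemannXi (1 / 2 + z - h) / riemannXi (1 / 2 + z + h)) {z : ℂ | 0 ≤ z.re} := by
    have := riemannXi.differentiable
    exact DifferentiableOn.div (by fun_prop) (by fun_prop) hne
  have key := PhragmenLindelof.right_half_plane_of_bounded_on_real
    (f := fun z => riemannXi (1 / 2 + z - h) / riemannXi (1 / 2 + z + h)) (C := 1) (z := z)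
    ?_ ⟨1, by norm_num, K + 2, ?_⟩ ?_ ?_ hz
  · rwa [norm_div, div_le_one (norm_pos_iff.mpr (hne z hz))] at key
  · refine DifferentiableOn.diffContOnCl (hdiff.mono ?_)
    exact (isClosed_le continuous_const continuous_re).closure_subset_iff.mpr
      fun w (hw : 0 < w.re) => hw.le
  · refine Asymptotics.IsBigO.of_bound (4 * C * Real.exp K + D) ?_
    refine Filter.eventually_inf_principal.mpr (Filter.Eventually.of_forall fun w hw => ?_)
    rw [Real.norm_eq_abs, Real.abs_exp, Real.rpow_one]
    have hE : 1 ≤ Real.exp ((K + 2) * ‖w‖) := Real.one_le_exp (by positivity)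
    rcases le_total w.re (7 / 8) with h1 | h1
    · refine (hnear w hw h1).trans ?_
      gcongr
      linarith
    · refine (hfar w h1).trans ?_
      have : 0 < 4 * C * Real.exp K := by positivity
      nlinarith
  · refine Filter.isBoundedUnder_of_eventually_le (a := D) ?_
    filter_upwards [Filter.eventually_ge_atTop 1] with x hx
    exact hfar x (by simp; linarith)
  · intro y
    have h0 : ‖riemannXi (1 / 2 + y * I + h)‖ ≠ 0 := norm_ne_zero_iff.mpr (hne _ (by simp))
    have h1 := norm_reflect (y * I - h)
    have h2 : (1 / 2 : ℂ) - conj (y * I - h) = 1 / 2 + y * I + h := by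
      simp
      ring
    rw [h2, ← add_sub_assoc] at h1
    rw [norm_div, h1, div_self h0]

theorem riemannXi.re_logDeriv_nonneg
    (RH : ∀ s : ℂ, riemannZeta s = 0 → 0 < s.re → s.re < 1 → s.re = 1 / 2)
    {s : ℂ} (hs : 1 / 2 < s.re) : 0 ≤ (logDeriv riemannXi s).re := by
  have hne := ne_zero RH hs
  set q : ℝ → ℂ := fun h => riemannXi (s + h) / riemannXi s with hq
  have hq1 : HasDerivAt q (logDeriv riemannXi s) 0 := by
    have h1 : HasDerivAt (fun h : ℂ => riemannXi (s + h)) (deriv riemannXi (s + 0)) 0 :=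
      (differentiable (s + 0)).hasDerivAt.comp_const_add s 0
    have := (h1.div_const (riemannXi s)).comp_ofReal (z := 0)
    simpa [logDeriv_apply] using this
  have hq2 : HasDerivAt (fun h => q (-h)) (-logDeriv riemannXi s) 0 := by
    have h2 : HasDerivAt q (logDeriv riemannXi s) (-0) := by simpa using hq1
    exact (h2.scomp (0 : ℝ) (hasDerivAt_neg (0 : ℝ))).congr_deriv (by simp)
  have hd1 : HasDerivAt (fun h => ‖q h‖ ^ 2 - ‖q (-h)‖ ^ 2)
      (4 * (logDeriv riemannXi s).re) 0 := by
    have := hq1.norm_sq.sub hq2.norm_sq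
    have hq0 : q 0 = 1 := by simp [hq, hne]
    refine this.congr_deriv ?_
    simp [hq0]
    ring
  by_contra! hlt
  have h3 := hd1.tendsto_slope_zero_right
  have h4 : ∀ᶠ h : ℝ in 𝓝[>] 0, 0 ≤ h⁻¹ • ((‖q (0 + h)‖ ^ 2 - ‖q (-(0 + h))‖ ^ 2) -
      (‖q 0‖ ^ 2 - ‖q (-0)‖ ^ 2)) := by
    filter_upwards [Ioc_mem_nhdsGT (show (0 : ℝ) < 1 / 8 by norm_num)] with h hh
    have h5 := norm_sub_le_norm_add RH hh.1 hh.2 (z := s - 1 / 2) (by norm_num; linarith)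
    rw [add_sub_cancel] at h5
    have h6 : ‖q (-h)‖ ≤ ‖q h‖ := by
      simp only [hq, norm_div, ofReal_neg, ← sub_eq_add_neg]
      gcongr
    have h7 : 0 < h⁻¹ := inv_pos.mpr hh.1
    simp only [zero_add, neg_zero, sub_self, sub_zero, smul_eq_mul]
    have : ‖q (-h)‖ ^ 2 ≤ ‖q h‖ ^ 2 := by gcongr
    have : 0 ≤ ‖q h‖ ^ 2 - ‖q (-h)‖ ^ 2 := by linarith
    positivity
  have := ge_of_tendsto h3 h4
  linarith

end

section

open Complex ComplexConjugate MeasureTheory Set Filter Topology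

theorem Complex.norm_sub_ofReal_sq (s : ℂ) (a : ℝ) :
    ‖s - a‖ ^ 2 = ‖s + a‖ ^ 2 - 4 * a * s.re := by
  rw [← normSq_eq_norm_sq, ← normSq_eq_norm_sq, normSq_apply, normSq_apply]
  simp
  ring

/-- The Schwarz–Pick inequality in the right half-plane. -/
theorem Complex.schwarzPick_of_re_pos {H : ℂ → ℂ} (hd : DifferentiableOn ℂ H {s | 0 < s.re})
    (hpos : ∀ s : ℂ, 0 < s.re → 0 < (H s).re) {a b : ℝ} (ha : 0 < a) (hab : H a = b) {s : ℂ}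
    (hs : 0 < s.re) : ‖H s + b‖ ^ 2 * (a * s.re) ≤ (H s).re * b * ‖s + a‖ ^ 2 := by
  have hb : 0 < b := by simpa [hab] using hpos a (by simpa)
  have hadd : ∀ {w : ℂ} {c : ℝ}, 0 < w.re → 0 < c → w + c ≠ 0 := by
    intro w c hw hc h0
    have := congrArg re h0
    simp at this
    linarith
  have hone : ∀ ζ ∈ Metric.ball (0 : ℂ) 1, 1 - ζ ≠ 0 := by
    intro ζ hζ h0
    rw [← sub_eq_zero.mp h0] at hζ
    simp at hζ
  have hre : ∀ ζ ∈ Metric.ball (0 : ℂ) 1, 0 < ((a : ℂ) * (1 + ζ) / (1 - ζ)).re := by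
    intro ζ hζ
    have h1 := hone ζ hζ
    have h2 : (a : ℂ) * (1 + ζ) / (1 - ζ) =
        ((a * (1 - ‖ζ‖ ^ 2) / ‖1 - ζ‖ ^ 2 : ℝ) : ℂ) + (a * 2 * ζ.im / ‖1 - ζ‖ ^ 2 : ℝ) * I := by
      have h3 : ((‖1 - ζ‖ ^ 2 : ℝ) : ℂ) ≠ 0 := by
        rw [ofReal_ne_zero]
        exact pow_ne_zero 2 (norm_ne_zero_iff.mpr h1)
      rw [ofReal_div, ofReal_div, div_mul_eq_mul_div, ← add_div, div_eq_div_iff h1 h3,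
        ← normSq_eq_norm_sq, ← normSq_eq_norm_sq, normSq_apply, normSq_apply]
      apply Complex.ext <;> simp <;> ring
    rw [h2]
    simp only [add_re, ofReal_re, re_ofReal_mul, I_re, mul_zero, add_zero]
    have h3 : ‖ζ‖ ^ 2 < 1 := by
      rw [mem_ball_zero_iff] at hζ
      have := norm_nonneg ζ
      nlinarith
    have h4 : 0 < ‖1 - ζ‖ := norm_pos_iff.mpr h1
    have : 0 < 1 - ‖ζ‖ ^ 2 := by linarith
    positivity
  set g : ℂ → ℂ := fun ζ => (H (a * (1 + ζ) / (1 - ζ)) - b) / (H (a * (1 + ζ) / (1 - ζ)) + b)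
    with hg
  have hlt : ∀ {w : ℂ} {c : ℝ}, 0 < w.re → 0 < c → ‖(w - c) / (w + c)‖ < 1 := by
    intro w c hw hc
    rw [norm_div, div_lt_one (norm_pos_iff.mpr (hadd hw hc))]
    apply lt_of_pow_lt_pow_left₀ 2 (norm_nonneg _)
    rw [norm_sub_ofReal_sq]
    have : 0 < 4 * c * w.re := by positivity
    linarith
  have hgd : DifferentiableOn ℂ g (Metric.ball 0 1) := by
    have h1 : DifferentiableOn ℂ (fun ζ : ℂ => H (a * (1 + ζ) / (1 - ζ))) (Metric.ball 0 1) :=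
      hd.comp (DifferentiableOn.div (by fun_prop) (by fun_prop) hone) hre
    exact DifferentiableOn.div (h1.sub_const _) (h1.add_const _)
      fun ζ hζ => hadd (hpos _ (hre ζ hζ)) hb
  have hgm : MapsTo g (Metric.ball 0 1) (Metric.closedBall 0 1) := fun ζ hζ =>
    mem_closedBall_zero_iff.mpr (hlt (hpos _ (hre ζ hζ)) hb).le
  have key := norm_le_norm_of_mapsTo_ball hgd hgm (by simp [hg, hab]) (hlt hs ha)
  have hsa := hadd hs ha
  have ha' : (a : ℂ) ≠ 0 := by exact_mod_cast ha.ne'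
  have hinv : (a : ℂ) * (1 + (s - a) / (s + a)) / (1 - (s - a) / (s + a)) = s := by
    have h1 : (a : ℂ) * (1 + (s - a) / (s + a)) = a * 2 * s / (s + a) := by
      field_simp; ring
    have h2 : 1 - (s - a) / (s + a) = 2 * a / (s + a) := by
      field_simp; ring
    rw [h1, h2]
    field_simp
  simp only [hg, hinv, norm_div] at key
  have h1 : 0 < ‖s + a‖ := norm_pos_iff.mpr hsa
  have h2 : 0 < ‖H s + b‖ := norm_pos_iff.mpr (hadd (hpos s hs) hb)
  rw [div_le_div_iff₀ h2 h1] at key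
  have h3 := pow_le_pow_left₀ (by positivity) key 2
  rw [mul_pow, mul_pow, norm_sub_ofReal_sq, norm_sub_ofReal_sq] at h3
  linarith

theorem Complex.schwarzPick_of_re_nonneg {H : ℂ → ℂ} (hd : DifferentiableOn ℂ H {s | 0 < s.re})
    (hpos : ∀ s : ℂ, 0 < s.re → 0 ≤ (H s).re) {a b : ℝ} (ha : 0 < a) (hab : H a = b) {s : ℂ}
    (hs : 0 < s.re) : ‖H s + b‖ ^ 2 * (a * s.re) ≤ (H s).re * b * ‖s + a‖ ^ 2 := by
  have key : ∀ᶠ ε : ℝ in 𝓝[>] 0, ‖H s + ε + (b + ε : ℝ)‖ ^ 2 * (a * s.re) ≤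
      (H s + ε).re * (b + ε) * ‖s + a‖ ^ 2 := by
    filter_upwards [self_mem_nhdsWithin] with ε (hε : 0 < ε)
    exact schwarzPick_of_re_pos (H := fun s => H s + ε) (by fun_prop)
      (fun w hw => by have := hpos w hw; simp; linarith) ha (by simp [hab]) hs
  refine le_of_tendsto_of_tendsto (f := fun ε : ℝ => ‖H s + ε + (b + ε : ℝ)‖ ^ 2 * (a * s.re))
    (g := fun ε : ℝ => (H s + ε).re * (b + ε) * ‖s + a‖ ^ 2) ?_ ?_ key
  · exact (Continuous.tendsto' (by fun_prop) _ _ (by simp)).mono_left nhdsWithin_le_nhds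
  · exact (Continuous.tendsto' (by fun_prop) _ _ (by simp)).mono_left nhdsWithin_le_nhds

theorem Complex.re_pick_nonneg {H : ℂ → ℂ} (hd : DifferentiableOn ℂ H {s | 0 < s.re})
    (hpos : ∀ s : ℂ, 0 < s.re → 0 ≤ (H s).re) {b : ℝ} (hb : H (1 / 2 : ℝ) = b) {s : ℂ}
    (hs : 0 < s.re) : 0 ≤ ((H s - 2 * s * b) / (1 / 4 - s ^ 2)).re := by
  have hb0 : 0 ≤ b := by
    have := hpos (1 / 2 : ℝ) (by norm_num)
    rwa [hb, ofReal_re] at this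
  have key := schwarzPick_of_re_nonneg hd hpos (by norm_num : (0 : ℝ) < 1 / 2) hb hs
  have hu := hpos s hs
  set u := (H s).re with hu'
  set v := (H s).im with hv'
  set σ := s.re with hσ
  set τ := s.im with hτ
  rw [← normSq_eq_norm_sq, ← normSq_eq_norm_sq, normSq_apply, normSq_apply] at key
  simp only [add_re, ofReal_re, add_im, ofReal_im, add_zero, ← hu', ← hv', ← hσ, ← hτ] at key
  set P := (σ + 1 / 2) * (σ + 1 / 2) + τ * τ with hP
  have hP0 : 0 < P := by
    have : 0 < σ + 1 / 2 := by positivity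
    exact add_pos_of_pos_of_nonneg (by positivity) (mul_self_nonneg τ)
  set R := (u + b) * (σ + 1 / 2) + v * τ with hR
  have hR1 : R ^ 2 ≤ ((u + b) * (u + b) + v * v) * P := by
    rw [hR, hP]
    nlinarith [sq_nonneg ((u + b) * τ - v * (σ + 1 / 2))]
  have hR2 : (2 * σ * R) ^ 2 ≤ (2 * b * σ * P + u * P) ^ 2 := by
    have h1 : (2 * σ * R) ^ 2 ≤ 4 * σ ^ 2 * (((u + b) * (u + b) + v * v) * P) := by
      nlinarith [mul_le_mul_of_nonneg_left hR1 (sq_nonneg σ)]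
    have h2 : 4 * σ ^ 2 * (((u + b) * (u + b) + v * v) * P) ≤ 8 * σ * P * (u * b * P) := by
      have : 0 ≤ 8 * σ * P := by positivity
      nlinarith [mul_le_mul_of_nonneg_left key this]
    nlinarith [sq_nonneg (2 * b * σ * P - u * P)]
  have hN := abs_le_of_sq_le_sq' hR2 (by positivity)
  rw [div_eq_mul_inv, inv_def, ← mul_assoc, re_mul_ofReal]
  refine mul_nonneg ?_ (inv_nonneg.mpr (normSq_nonneg _))
  have : ((H s - 2 * s * b) * conj (1 / 4 - s ^ 2)).re =
      2 * b * σ * P + u * P - 2 * σ * R := by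
    have e : s ^ 2 = s * s := sq s
    simp [e, ← hu', ← hv', ← hσ, ← hτ]
    rw [hP, hR]
    ring
  rw [this]
  linarith [hN.2]

theorem riemannXi.re_pick_nonneg
    (RH : ∀ s : ℂ, riemannZeta s = 0 → 0 < s.re → s.re < 1 → s.re = 1 / 2)
    {b : ℝ} (hb : completedRiemannZeta₀ 1 = b) {w : ℂ} (hw : 1 / 2 < w.re) :
    0 ≤ (((2 * w - 1) * b - logDeriv riemannXi w) / (w * (w - 1))).re := by
  have h1 : logDeriv riemannXi 1 = b := by
    rw [logDeriv_apply, hasDerivAt_one.deriv, apply_one, hb, div_one]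
  have hd : DifferentiableOn ℂ (fun s => logDeriv riemannXi (1 / 2 + s)) {s | 0 < s.re} := by
    have h2 : DifferentiableOn ℂ (logDeriv riemannXi) {s | 1 / 2 < s.re} :=
      DifferentiableOn.div (differentiable.differentiableOn.deriv
        (isOpen_lt continuous_const continuous_re)) differentiable.differentiableOn
        fun s hs => ne_zero RH hs
    exact h2.comp (by fun_prop) fun s (hs : 0 < s.re) => by
      change 1 / 2 < (1 / 2 + s).re
      norm_num
      linarith
  have key := Complex.re_pick_nonneg hd
    (fun s hs => re_logDeriv_nonneg RH (by norm_num; linarith)) (b := b)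
    (by norm_num [h1]) (s := w - 1 / 2) (by norm_num; linarith)
  convert key using 2
  rw [add_sub_cancel, ← neg_div_neg_eq]
  congr 1 <;> ring

end

section

open Complex ComplexConjugate MeasureTheory Set Filter Topology

theorem Real.monotoneOn_logDeriv_Gamma : MonotoneOn (logDeriv Real.Gamma) (Ioi 0) := by
  have hd : ∀ x ∈ Ioi (0 : ℝ), DifferentiableAt ℝ Real.Gamma x := fun x (hx : 0 < x) =>
    Real.differentiableAt_Gamma fun m => by
      have : (0 : ℝ) ≤ m := m.cast_nonneg
      linarith
  have hne : ∀ x ∈ Ioi (0 : ℝ), Real.Gamma x ≠ 0 := fun x hx => (Real.Gamma_pos_of_pos hx).ne'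
  refine (Real.convexOn_log_Gamma.monotoneOn_deriv fun x hx =>
    (Real.differentiableAt_log (hne x hx)).comp x (hd x hx)).congr fun x hx => ?_
  rw [logDeriv_apply]
  exact deriv.log (hd x hx) (hne x hx)

theorem Complex.differentiableAt_Gamma_of_re_pos {s : ℂ} (hs : 0 < s.re) :
    DifferentiableAt ℂ Gamma s :=
  differentiableAt_Gamma s fun m h => by
    rw [h] at hs
    have : (0 : ℝ) ≤ m := m.cast_nonneg
    simp at hs
    linarith

theorem Complex.digamma_ofReal {x : ℝ} (hx : 0 < x) : digamma x = (logDeriv Real.Gamma x : ℝ) := by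
  have h1 := (differentiableAt_Gamma_of_re_pos (s := x) (by simpa)).hasDerivAt.comp_ofReal
  have h2 := (Real.differentiableAt_Gamma (s := x) fun m => by
    have : (0 : ℝ) ≤ m := m.cast_nonneg
    linarith).hasDerivAt.ofReal_comp
  simp only [Gamma_ofReal] at h1
  rw [digamma_def, logDeriv_apply, logDeriv_apply, h1.unique h2, Gamma_ofReal, ofReal_div]

theorem Complex.summable_digamma_add_one {s : ℂ} (hs : 0 < s.re) :
    Summable fun n : ℕ => s / ((n + 1) * (n + 1 + s)) := by
  have h : Summable fun n : ℕ => ‖s‖ * (1 / ((n + 1 : ℕ) : ℝ) ^ 2) :=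
    ((summable_nat_add_iff 1).mpr (Real.summable_one_div_nat_pow.mpr one_lt_two)).mul_left _
  refine Summable.of_norm_bounded h fun n => ?_
  have h1 : (n + 1 : ℝ) ≤ ‖(n + 1 + s : ℂ)‖ := by
    refine le_trans ?_ (re_le_norm _)
    simp; linarith
  have h2 : ‖(n + 1 : ℂ)‖ = n + 1 := by exact_mod_cast Complex.norm_natCast (n + 1)
  rw [norm_div, norm_mul, h2, div_eq_mul_one_div]
  push_cast
  rw [sq]
  gcongr

theorem Real.hasSum_logDeriv_Gamma_add_one {x : ℝ} (hx : 0 < x) :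
    HasSum (fun n : ℕ => x / ((n + 1) * (n + 1 + x)))
      (logDeriv Real.Gamma (x + 1) + eulerMascheroniConstant) := by
  set ψ := logDeriv Real.Gamma with hψ
  have hadd : ∀ y : ℝ, 0 < y → ψ (y + 1) = ψ y + y⁻¹ := by
    intro y hy
    have h := digamma_apply_add_one (y : ℂ) fun m h => by
      have h0 : y = -(m : ℝ) := by exact_mod_cast h
      have : (0 : ℝ) ≤ m := m.cast_nonneg
      linarith
    have h1 := digamma_ofReal (x := y + 1) (by positivity)
    push_cast at h1
    rw [h1, digamma_ofReal hy] at h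
    exact_mod_cast h
  have hone : ψ 1 = -eulerMascheroniConstant := by
    have h := digamma_ofReal (x := 1) one_pos
    rw [ofReal_one, digamma_one] at h
    exact_mod_cast h.symm
  have hsum : ∀ y : ℝ, 0 < y → ∀ N : ℕ,
      ψ (y + N) = ψ y + ∑ n ∈ Finset.range N, 1 / (n + y) := by
    intro y hy N
    induction N with
    | zero => simp
    | succ N ih =>
      rw [Finset.sum_range_succ, Nat.cast_succ, ← add_assoc, hadd _ (by positivity), ih,
        one_div, add_comm (N : ℝ) y, add_assoc]
  rw [hasSum_iff_tendsto_nat_of_nonneg (fun n => by positivity)]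
  have hpart : ∀ N : ℕ, ∑ n ∈ Finset.range N, x / ((n + 1) * (n + 1 + x)) =
      (ψ (x + 1) + eulerMascheroniConstant) - (ψ (x + 1 + N) - ψ (1 + N)) := by
    intro N
    rw [hsum (x + 1) (by positivity) N, hsum 1 one_pos N, hone]
    have : ∑ n ∈ Finset.range N, x / ((n + 1) * (n + 1 + x)) =
        ∑ n ∈ Finset.range N, 1 / ((n : ℝ) + 1) - ∑ n ∈ Finset.range N, 1 / (n + (x + 1)) := by
      rw [← Finset.sum_sub_distrib]
      refine Finset.sum_congr rfl fun n _ => ?_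
      have : 0 < (n : ℝ) + (x + 1) := by positivity
      field_simp
      ring
    rw [this]
    ring
  simp only [hpart]
  have hmono := Real.monotoneOn_logDeriv_Gamma
  have hlim : Tendsto (fun N : ℕ => ψ (x + 1 + N) - ψ (1 + N)) atTop (𝓝 0) := by
    obtain ⟨k, hk⟩ := exists_nat_ge x
    have h0 : Tendsto (fun N : ℕ => (k : ℝ) * (1 / ((N : ℝ) + 1))) atTop (𝓝 0) := by
      simpa using tendsto_one_div_add_atTop_nhds_zero_nat.const_mul (k : ℝ)
    refine squeeze_zero (fun N => ?_) (fun N => ?_) h0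
    · exact sub_nonneg.mpr (hmono (by simp; positivity) (by simp; positivity) (by linarith))
    · have h1 : ψ (x + 1 + N) ≤ ψ (1 + N + k) :=
        hmono (by simp; positivity) (by simp; positivity) (by linarith)
      rw [hsum (1 + N) (by positivity) k] at h1
      have h2 : ∑ n ∈ Finset.range k, 1 / ((n : ℝ) + (1 + N)) ≤
          ∑ n ∈ Finset.range k, 1 / ((N : ℝ) + 1) := by
        refine Finset.sum_le_sum fun n _ => ?_
        have : (0 : ℝ) ≤ n := n.cast_nonneg
        exact one_div_le_one_div_of_le (by positivity) (by linarith)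
      rw [Finset.sum_const, Finset.card_range, nsmul_eq_mul] at h2
      linarith
  simpa using hlim.const_sub (ψ (x + 1) + eulerMascheroniConstant)

theorem Complex.hasSum_digamma_add_one {s : ℂ} (hs : 0 < s.re) :
    HasSum (fun n : ℕ => s / ((n + 1) * (n + 1 + s)))
      (digamma (s + 1) + Real.eulerMascheroniConstant) := by
  refine (summable_digamma_add_one hs).hasSum_iff.mpr ?_
  set R := ‖s‖ + 2 with hR
  set U : Set ℂ := {z | 0 < z.re} ∩ Metric.ball 0 R with hU
  have hUo : IsOpen U := (isOpen_lt continuous_const continuous_re).inter Metric.isOpen_ball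
  have hUc : IsPreconnected U :=
    ((convex_halfSpace_re_gt 0).inter (convex_ball 0 R)).isPreconnected
  have hne : ∀ (n : ℕ) (z : ℂ), 0 < z.re → (n + 1 : ℂ) * (n + 1 + z) ≠ 0 := by
    intro n z hz
    refine mul_ne_zero (by exact_mod_cast n.succ_ne_zero) fun h => ?_
    have := congrArg re h
    simp at this
    have : (0 : ℝ) ≤ n := n.cast_nonneg
    linarith
  have hd1 : DifferentiableOn ℂ (fun z : ℂ => ∑' n : ℕ, z / ((n + 1) * (n + 1 + z))) U := by
    refine differentiableOn_tsum_of_summable_norm (u := fun n : ℕ => R * (1 / ((n + 1 : ℕ) : ℝ) ^ 2))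
      (((summable_nat_add_iff 1).mpr (Real.summable_one_div_nat_pow.mpr one_lt_two)).mul_left _)
      (fun n => ?_) hUo fun n z hz => ?_
    · exact DifferentiableOn.div (by fun_prop) (by fun_prop) fun z hz => hne n z hz.1
    · have h1 : (n + 1 : ℝ) ≤ ‖(n + 1 + z : ℂ)‖ := by
        refine le_trans ?_ (re_le_norm _)
        have : 0 < z.re := hz.1
        simp; linarith
      have h2 : ‖(n + 1 : ℂ)‖ = n + 1 := by exact_mod_cast Complex.norm_natCast (n + 1)
      rw [norm_div, norm_mul, h2, div_eq_mul_one_div]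
      push_cast
      rw [sq]
      gcongr
      exact (mem_ball_zero_iff.mp hz.2).le
  have hd2 : DifferentiableOn ℂ (fun z : ℂ => digamma (z + 1) + Real.eulerMascheroniConstant) U := by
    refine DifferentiableOn.add_const _ ?_
    have h : DifferentiableOn ℂ digamma {z | 0 < z.re} := by
      have h1 : DifferentiableOn ℂ Gamma {z | 0 < z.re} := fun z hz =>
        (differentiableAt_Gamma_of_re_pos hz).differentiableWithinAt
      exact (h1.deriv (isOpen_lt continuous_const continuous_re)).div h1
        fun z hz => Gamma_ne_zero_of_re_pos hz
    refine h.comp (by fun_prop) fun z hz => ?_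
    have : 0 < z.re := hz.1
    change 0 < (z + 1).re
    simp
    linarith
  refine (hd1.analyticOnNhd hUo).eqOn_of_preconnected_of_frequently_eq (hd2.analyticOnNhd hUo) hUc
    (z₀ := 1) ⟨by simp, by rw [mem_ball_zero_iff, norm_one, hR]; linarith [norm_nonneg s]⟩ ?_ ⟨hs, by simp [hR]⟩
  have hreal : ∀ x : ℝ, 0 < x → ∑' n : ℕ, (x : ℂ) / ((n + 1) * (n + 1 + x)) =
      digamma (x + 1) + Real.eulerMascheroniConstant := by
    intro x hx
    have h := (Real.hasSum_logDeriv_Gamma_add_one hx).tsum_eq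
    have h1 := digamma_ofReal (x := x + 1) (by positivity)
    push_cast at h1
    rw [h1, ← ofReal_add, ← h, ofReal_tsum]
    push_cast
    rfl
  have ht : Tendsto (fun x : ℝ => (x : ℂ)) (𝓝[≠] 1) (𝓝[≠] 1) := by
    refine tendsto_nhdsWithin_iff.mpr ⟨?_, ?_⟩
    · exact (continuous_ofReal.tendsto' 1 1 (by simp)).mono_left nhdsWithin_le_nhds
    · filter_upwards [self_mem_nhdsWithin] with x hx
      simpa using hx
  refine ht.frequently (Eventually.frequently ?_)
  filter_upwards [nhdsWithin_le_nhds (lt_mem_nhds (show (0 : ℝ) < 1 by norm_num))] with x hx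
  exact hreal x hx

end

section

open Complex ComplexConjugate MeasureTheory Set Filter Topology

theorem riemannXi.logDeriv_eq {w : ℂ} (hw : 1 < w.re) :
    logDeriv riemannXi w = 1 / (w - 1) -
      (Real.log Real.pi + Real.eulerMascheroniConstant) / 2 +
      ∑' n : ℕ, w / ((2 * (n + 1)) * (w + 2 * (n + 1))) +
      deriv riemannZeta w / riemannZeta w := by
  have hpi : (Real.pi : ℂ) ≠ 0 := by exact_mod_cast Real.pi_ne_zero
  have heq : riemannXi =ᶠ[𝓝 w] fun s => 2 * (s - 1) * ((Real.pi : ℂ) ^ (-s / 2) *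
      (Gamma (s / 2 + 1) * riemannZeta s)) := by
    filter_upwards [(isOpen_lt continuous_const continuous_re).mem_nhds hw] with s (hs : 1 < s.re)
    have hs0 : s ≠ 0 := by rintro rfl; simp at hs; linarith
    rw [eq_riemannZeta (by linarith) (by rintro rfl; simp at hs), Gammaℝ_def,
      Gamma_add_one _ (div_ne_zero hs0 two_ne_zero)]
    ring
  have hw1 : w - 1 ≠ 0 := sub_ne_zero.mpr (by rintro rfl; simp at hw)
  have hw2 : 0 < (w / 2).re := by simp; linarith
  have hw3 : 0 < (w / 2 + 1).re := by simp; linarith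
  have hz : riemannZeta w ≠ 0 := riemannZeta_ne_zero_of_one_le_re hw.le
  have hzd : DifferentiableAt ℂ riemannZeta w :=
    differentiableAt_riemannZeta (sub_ne_zero.mp hw1)
  have hGd : DifferentiableAt ℂ (fun s => Gamma (s / 2 + 1)) w :=
    (differentiableAt_Gamma_of_re_pos hw3).comp w (by fun_prop)
  have hpd : HasDerivAt (fun s : ℂ => (Real.pi : ℂ) ^ (-s / 2))
      ((Real.pi : ℂ) ^ (-w / 2) * log Real.pi * (-1 / 2)) w :=
    ((hasDerivAt_neg' w).div_const 2).const_cpow (Or.inl hpi)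
  have hpne : (Real.pi : ℂ) ^ (-w / 2) ≠ 0 := by simp [cpow_eq_zero_iff, hpi]
  have hGne := Gamma_ne_zero_of_re_pos hw3
  rw [logDeriv_apply, heq.deriv_eq, heq.eq_of_nhds, ← logDeriv_apply,
    logDeriv_mul (f := fun s : ℂ => 2 * (s - 1))
      (g := fun s => (Real.pi : ℂ) ^ (-s / 2) * (Gamma (s / 2 + 1) * riemannZeta s)) w
      (mul_ne_zero two_ne_zero hw1) (mul_ne_zero hpne (mul_ne_zero hGne hz))
      (by fun_prop) (hpd.differentiableAt.fun_mul (hGd.fun_mul hzd)),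
    logDeriv_mul (f := fun s : ℂ => (Real.pi : ℂ) ^ (-s / 2))
      (g := fun s => Gamma (s / 2 + 1) * riemannZeta s) w hpne (mul_ne_zero hGne hz) hpd.differentiableAt (hGd.fun_mul hzd),
    logDeriv_mul (f := fun s => Gamma (s / 2 + 1)) (g := riemannZeta) w hGne hz hGd hzd]
  have e1 : logDeriv (fun s : ℂ => 2 * (s - 1)) w = 1 / (w - 1) := by
    have : HasDerivAt (fun s : ℂ => 2 * (s - 1)) (2 * 1) w :=
      ((hasDerivAt_id' w).sub_const 1).const_mul 2
    rw [logDeriv_apply, this.deriv]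
    field_simp
  have e2 : logDeriv (fun s : ℂ => (Real.pi : ℂ) ^ (-s / 2)) w = -Real.log Real.pi / 2 := by
    rw [logDeriv_apply, hpd.deriv, ofReal_log Real.pi_pos.le]
    field_simp
  have e3 : logDeriv (fun s : ℂ => Gamma (s / 2 + 1)) w = digamma (w / 2 + 1) / 2 := by
    have : HasDerivAt (fun s : ℂ => Gamma (s / 2 + 1)) (deriv Gamma (w / 2 + 1) * (1 / 2)) w :=
      (differentiableAt_Gamma_of_re_pos hw3).hasDerivAt.comp w
        (((hasDerivAt_id' w).div_const 2).add_const 1)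
    rw [logDeriv_apply, this.deriv, digamma_def, logDeriv_apply]
    ring
  have e4 : ∑' n : ℕ, w / ((2 * (n + 1)) * (w + 2 * (n + 1))) =
      (digamma (w / 2 + 1) + Real.eulerMascheroniConstant) / 2 := by
    rw [← ((hasSum_digamma_add_one hw2).div_const 2).tsum_eq]
    refine tsum_congr fun n => ?_
    rw [div_div, div_div, show (2 * (n + 1) * (w + 2 * (n + 1)) : ℂ) =
      2 * ((n + 1) * (n + 1 + w / 2) * 2) by ring]
  rw [e1, e2, e3, e4, logDeriv_apply]
  ring

theorem Complex.sqrt_mul_sqrt_le_norm_add_ofReal {w : ℂ} (hw : 0 ≤ w.re) {a : ℝ} (ha : 0 ≤ a) :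
    √a * √‖w‖ ≤ ‖w + a‖ := by
  have h1 : a ≤ ‖w + a‖ := by
    refine le_trans ?_ (re_le_norm _)
    simpa
  have h2 : ‖w‖ ≤ ‖w + a‖ := by
    rw [norm_def, norm_def]
    apply Real.sqrt_le_sqrt
    simp only [normSq_apply, add_re, ofReal_re, add_im, ofReal_im, add_zero]
    nlinarith
  rw [← Real.sqrt_mul ha, Real.sqrt_le_left (norm_nonneg _), sq]
  gcongr

theorem riemannXi.exists_bound_logDeriv_three_halves :
    ∃ C, 0 < C ∧ ∀ w : ℂ, w.re = 3 / 2 → ‖logDeriv riemannXi w‖ ≤ C * (1 + √‖w‖) := by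
  obtain ⟨C, hC0, hC⟩ := exists_bound_riemannZeta (σ := 3 / 2) (by norm_num)
  set A := ‖((Real.log Real.pi + Real.eulerMascheroniConstant) / 2 : ℂ)‖
  have hsum : Summable fun n : ℕ => 1 / ((n : ℝ) + 1) ^ (3 / 2 : ℝ) := by
    have := (summable_nat_add_iff 1).mpr
      (Real.summable_one_div_nat_rpow.mpr (show (1 : ℝ) < 3 / 2 by norm_num))
    simpa using this
  set D := ∑' n : ℕ, 1 / ((n : ℝ) + 1) ^ (3 / 2 : ℝ)
  have hD0 : 0 ≤ D := tsum_nonneg fun n => by positivity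
  have hA0 : 0 ≤ A := norm_nonneg _
  refine ⟨2 + A + D + C, by positivity, fun w hw => ?_⟩
  rw [logDeriv_eq (by rw [hw]; norm_num)]
  have e1 : ‖1 / (w - 1)‖ ≤ 2 := by
    have h : 1 / 2 ≤ ‖w - 1‖ := by
      refine le_trans ?_ (re_le_norm _)
      rw [sub_re, hw]; norm_num
    rw [norm_div, norm_one]
    exact (one_div_le_one_div_of_le (by norm_num) h).trans (by norm_num)
  have e2 : ‖∑' n : ℕ, w / ((2 * (n + 1)) * (w + 2 * (n + 1)))‖ ≤ √‖w‖ * D := by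
    refine tsum_of_norm_bounded (hsum.hasSum.mul_left _) fun n => ?_
    have h1 := sqrt_mul_sqrt_le_norm_add_ofReal (w := w) (by rw [hw]; norm_num)
      (a := 2 * (n + 1)) (by positivity)
    have hw0 : 0 < ‖w‖ := norm_pos_iff.mpr (by rintro rfl; norm_num at hw)
    have h2 : √((n : ℝ) + 1) * √‖w‖ ≤ ‖w + 2 * (n + 1)‖ := by
      have : √((n : ℝ) + 1) ≤ √(2 * (n + 1)) :=
        Real.sqrt_le_sqrt (by have : (0 : ℝ) ≤ n := n.cast_nonneg; linarith)
      push_cast at h1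
      exact (mul_le_mul_of_nonneg_right this (Real.sqrt_nonneg _)).trans h1
    have h3 : ‖(2 * (n + 1) : ℂ)‖ = 2 * (n + 1) := by
      have : (2 * (n + 1) : ℂ) = ((2 * (n + 1) : ℝ) : ℂ) := by push_cast; ring
      rw [this, norm_real, Real.norm_eq_abs, abs_of_nonneg (by positivity)]
    have h4 : ((n : ℝ) + 1) ^ (3 / 2 : ℝ) = (n + 1) * √((n : ℝ) + 1) := by
      rw [Real.sqrt_eq_rpow, show (3 / 2 : ℝ) = 1 + 1 / 2 by norm_num,
        Real.rpow_add (by positivity), Real.rpow_one]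
    rw [norm_div, norm_mul, h3, h4]
    calc ‖w‖ / (2 * (n + 1) * ‖w + 2 * (n + 1)‖)
        ≤ ‖w‖ / (1 * (n + 1) * (√((n : ℝ) + 1) * √‖w‖)) := by
          gcongr
          norm_num
      _ = √‖w‖ * (1 / ((n + 1) * √((n : ℝ) + 1))) := by
          have h5 : √‖w‖ ≠ 0 := (Real.sqrt_pos.mpr hw0).ne'
          have h6 : √((n : ℝ) + 1) ≠ 0 := (Real.sqrt_pos.mpr (by positivity)).ne'
          field_simp
          exact (Real.sq_sqrt (norm_nonneg _)).symm
  have e3 := (hC w hw.ge).2.2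
  have h0 := Real.sqrt_nonneg ‖w‖
  calc _ ≤ ‖1 / (w - 1)‖ + A + ‖∑' n : ℕ, w / ((2 * (n + 1)) * (w + 2 * (n + 1)))‖ +
        ‖deriv riemannZeta w / riemannZeta w‖ := by
        refine (norm_add_le _ _).trans ?_
        gcongr
        refine (norm_add_le _ _).trans ?_
        gcongr
        exact norm_sub_le _ _
    _ ≤ 2 + A + √‖w‖ * D + C := by gcongr
    _ ≤ _ := by nlinarith [mul_nonneg (show 0 ≤ 2 + A + C by positivity) h0]

end

section

open Complex ComplexConjugate MeasureTheory Set Filter Topology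

theorem Complex.integral_vertical_eq_of_norm_le {f : ℂ → ℂ} {a b C r : ℝ} (hab : a ≤ b)
    (hr : 1 < r) (hd : DifferentiableOn ℂ f {s | a ≤ s.re ∧ s.re ≤ b})
    (hf : ∀ s : ℂ, a ≤ s.re → s.re ≤ b → ‖f s‖ ≤ C * (1 + |s.im|) ^ (-r)) :
    ∫ y : ℝ, f (a + y * I) = ∫ y : ℝ, f (b + y * I) := by
  have hint : ∀ σ : ℝ, a ≤ σ → σ ≤ b → Integrable fun y : ℝ => f (σ + y * I) := by
    intro σ h1 h2
    refine ((integrable_one_add_norm (r := r) (by simpa)).const_mul C).mono'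
      (Continuous.aestronglyMeasurable ?_) (Eventually.of_forall fun y => ?_)
    · exact hd.continuousOn.comp_continuous (by fun_prop) fun y => by simp [h1, h2]
    · simpa using hf (σ + y * I) (by simpa) (by simpa)
  have hlim : Tendsto (fun T : ℝ => |C| * (1 + |T|) ^ (-r) * |b - a|) atTop (𝓝 0) := by
    have h1 : Tendsto (fun T : ℝ => (1 + |T|) ^ (-r)) atTop (𝓝 0) :=
      (tendsto_rpow_neg_atTop (by linarith)).comp
        (tendsto_atTop_add_const_left _ _ tendsto_abs_atTop_atTop)
    simpa using (h1.const_mul |C|).mul_const |b - a|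
  have hhor : ∀ T : ℝ, ‖∫ x in a..b, f (x + T * I)‖ ≤ |C| * (1 + |T|) ^ (-r) * |b - a| := by
    intro T
    refine intervalIntegral.norm_integral_le_of_norm_le_const fun x hx => ?_
    rw [uIoc_of_le hab] at hx
    have h0 : 0 ≤ (1 + |T|) ^ (-r) := by positivity
    refine (hf (x + T * I) (by simpa using hx.1.le) (by simpa using hx.2)).trans ?_
    simp only [add_im, ofReal_im, mul_im, ofReal_re, I_im, mul_one, I_re, mul_zero, add_zero,
      zero_add]
    gcongr
    exact le_abs_self C
  have hrect : ∀ T : ℝ, 0 ≤ T → (∫ y in (-T)..T, f (a + y * I)) - (∫ y in (-T)..T, f (b + y * I)) =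
      -I * ((∫ x in a..b, f (x + (-T : ℝ) * I)) - ∫ x in a..b, f (x + T * I)) := by
    intro T hT
    have := integral_boundary_rect_eq_zero_of_differentiableOn f ⟨a, -T⟩ ⟨b, T⟩
      (hd.mono fun s hs => by
        have h1 := hs.1
        rwa [mem_preimage, uIcc_of_le hab] at h1)
    simp only [smul_eq_mul] at this
    linear_combination I * this + ((∫ y in (-T)..T, f (a + y * I)) -
      (∫ y in (-T)..T, f (b + y * I))) * I_sq
  have h1 : Tendsto (fun T : ℝ => (∫ y in (-T)..T, f (a + y * I)) -
      (∫ y in (-T)..T, f (b + y * I))) atTop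
      (𝓝 ((∫ y : ℝ, f (a + y * I)) - ∫ y : ℝ, f (b + y * I))) :=
    (intervalIntegral_tendsto_integral (hint a le_rfl hab) tendsto_neg_atTop_atBot tendsto_id).sub
      (intervalIntegral_tendsto_integral (hint b hab le_rfl) tendsto_neg_atTop_atBot tendsto_id)
  have h2 : Tendsto (fun T : ℝ => (∫ y in (-T)..T, f (a + y * I)) -
      (∫ y in (-T)..T, f (b + y * I))) atTop (𝓝 0) := by
    refine squeeze_zero_norm' ?_ (by simpa using hlim.add hlim)
    filter_upwards [eventually_ge_atTop 0] with T hT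
    rw [hrect T hT, norm_mul, norm_neg, norm_I, one_mul]
    refine (norm_sub_le _ _).trans (add_le_add ?_ (hhor T))
    simpa using hhor (-T)
  exact sub_eq_zero.mp (tendsto_nhds_unique h1 h2)

namespace riemannXi

theorem differentiableOn_logDeriv
    (RH : ∀ s : ℂ, riemannZeta s = 0 → 0 < s.re → s.re < 1 → s.re = 1 / 2) :
    DifferentiableOn ℂ (logDeriv riemannXi) {s | 1 / 2 < s.re} :=
  DifferentiableOn.div (differentiable.differentiableOn.deriv
    (isOpen_lt continuous_const continuous_re)) differentiable.differentiableOn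
    fun _ hs => ne_zero RH hs

theorem exists_bound_logDeriv
    (RH : ∀ s : ℂ, riemannZeta s = 0 → 0 < s.re → s.re < 1 → s.re = 1 / 2)
    {σ : ℝ} (hσ : 1 / 2 < σ) :
    ∃ C, 0 < C ∧ ∀ w : ℂ, σ ≤ w.re → w.re ≤ 3 / 2 →
      ‖logDeriv riemannXi w‖ ≤ C * (1 + |w.im|) ^ (1 / 2 : ℝ) := by
  obtain ⟨C, hC0, hC⟩ := exists_bound_logDeriv_three_halves
  set ε := σ - 1 / 2 with hε
  have hε0 : 0 < ε := by linarith
  refine ⟨2 / ε + 6 * C / ε, by positivity, fun w h1 h2 => ?_⟩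
  set w₀ : ℂ := ⟨3 / 2, w.im⟩ with hw₀
  have hd1 : ‖w - w₀‖ = 3 / 2 - w.re := by
    have : w - w₀ = ((w.re - 3 / 2 : ℝ) : ℂ) := by
      apply Complex.ext <;> simp [hw₀]
    rw [this, norm_real, Real.norm_eq_abs, abs_of_nonpos (by linarith)]
    ring
  have hmem : ∀ z ∈ Metric.ball (0 : ℂ) 1, 1 / 2 < (w₀ + z).re := by
    intro z hz
    have h1 := abs_le.mp ((abs_re_le_norm z).trans (mem_ball_zero_iff.mp hz).le)
    have h2 := (abs_lt.mp ((abs_re_le_norm z).trans_lt (mem_ball_zero_iff.mp hz))).1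
    simp only [add_re, hw₀]
    linarith
  have key := borelCaratheodory (f := fun z => -logDeriv riemannXi (w₀ + z)) (M := 1) (R := 1)
    one_pos (((differentiableOn_logDeriv RH).comp (by fun_prop) hmem).neg)
    (fun z hz => by
      have := re_logDeriv_nonneg RH (hmem z hz)
      change (-logDeriv riemannXi (w₀ + z)).re ≤ 1
      rw [neg_re]
      linarith) one_pos (z := w - w₀) (by rw [mem_ball_zero_iff, hd1]; linarith)
  simp only [norm_neg, add_zero, add_sub_cancel, hd1] at key
  have hy := abs_nonneg w.im
  have hX : 1 ≤ (1 + |w.im|) ^ (1 / 2 : ℝ) := Real.one_le_rpow (by linarith) (by norm_num)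
  have hL0 : ‖logDeriv riemannXi w₀‖ ≤ 3 * C * (1 + |w.im|) ^ (1 / 2 : ℝ) := by
    have h3 : √‖w₀‖ ≤ 2 * (1 + |w.im|) ^ (1 / 2 : ℝ) := by
      rw [← Real.sqrt_eq_rpow, show (2 : ℝ) = √4 by rw [show (4 : ℝ) = 2 ^ 2 by norm_num]; simp,
        ← Real.sqrt_mul (by norm_num)]
      apply Real.sqrt_le_sqrt
      refine (norm_le_abs_re_add_abs_im w₀).trans ?_
      simp only [hw₀, abs_of_pos (show (0 : ℝ) < 3 / 2 by norm_num)]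
      linarith
    calc _ ≤ C * (1 + √‖w₀‖) := hC w₀ rfl
      _ ≤ C * ((1 + |w.im|) ^ (1 / 2 : ℝ) + 2 * (1 + |w.im|) ^ (1 / 2 : ℝ)) := by gcongr
      _ = _ := by ring
  have hden : ε ≤ 1 - (3 / 2 - w.re) := by linarith
  calc _ ≤ _ := key
    _ ≤ 2 * 1 * 1 / ε + (3 * C * (1 + |w.im|) ^ (1 / 2 : ℝ)) * 2 / ε := by
      gcongr <;> linarith
    _ ≤ 2 * (1 + |w.im|) ^ (1 / 2 : ℝ) / ε + (3 * C * (1 + |w.im|) ^ (1 / 2 : ℝ)) * 2 / ε := by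
      rw [mul_one, mul_one]
      gcongr
      linarith
    _ = _ := by ring

/-- The holomorphic extension of `(L 1 - L w) / (w (w - 1))`, where `L` is the logarithmic
derivative of `riemannXi`. -/
noncomputable def pickQuotient (w : ℂ) : ℂ := -dslope (logDeriv riemannXi) 1 w / w

theorem logDeriv_one : logDeriv riemannXi 1 = completedRiemannZeta₀ 1 := by
  rw [logDeriv_apply, hasDerivAt_one.deriv, apply_one, div_one]

theorem pickQuotient_eq {w : ℂ} (hw : w ≠ 1) :
    pickQuotient w = (completedRiemannZeta₀ 1 - logDeriv riemannXi w) / (w * (w - 1)) := by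
  rw [pickQuotient, dslope_of_ne _ hw, slope_def_field, logDeriv_one, ← neg_div, neg_sub, div_div,
    mul_comm]

theorem differentiableOn_pickQuotient
    (RH : ∀ s : ℂ, riemannZeta s = 0 → 0 < s.re → s.re < 1 → s.re = 1 / 2) :
    DifferentiableOn ℂ pickQuotient {s | 1 / 2 < s.re} := by
  refine DifferentiableOn.div (DifferentiableOn.neg ?_) differentiableOn_id ?_
  · exact (differentiableOn_dslope ((isOpen_lt continuous_const continuous_re).mem_nhds
      (by norm_num))).mpr (differentiableOn_logDeriv RH)
  · rintro s hs rfl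
    norm_num at hs

theorem exists_bound_pickQuotient
    (RH : ∀ s : ℂ, riemannZeta s = 0 → 0 < s.re → s.re < 1 → s.re = 1 / 2)
    {σ : ℝ} (hσ : 1 / 2 < σ) :
    ∃ C, 0 < C ∧ ∀ w : ℂ, σ ≤ w.re → w.re ≤ 3 / 2 →
      ‖pickQuotient w‖ ≤ C * (1 + |w.im|) ^ (-(3 / 2) : ℝ) := by
  obtain ⟨C, hC0, hC⟩ := exists_bound_logDeriv RH hσ
  have hcomp : IsCompact (Icc σ (3 / 2) ×ℂ Icc (-1) 1) := isCompact_Icc.reProdIm isCompact_Icc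
  obtain ⟨D, hD⟩ := hcomp.exists_bound_of_continuousOn
    ((differentiableOn_pickQuotient RH).continuousOn.mono fun w hw => by
      have : σ ≤ w.re := hw.1.1
      change 1 / 2 < w.re
      linarith)
  set b := ‖completedRiemannZeta₀ 1‖
  have hb : 0 ≤ b := norm_nonneg _
  refine ⟨4 * (b + C) + |D| * 2 ^ (3 / 2 : ℝ), by positivity, fun w h1 h2 => ?_⟩
  set y := 1 + |w.im| with hy
  have hy0 := abs_nonneg w.im
  have hy1 : 0 < y := by positivity
  have hY : 0 < y ^ (-(3 / 2) : ℝ) := by positivity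
  rcases le_total |w.im| 1 with h | h
  · have h3 := hD w ⟨⟨h1, h2⟩, abs_le.mp h⟩
    have h4 : 1 ≤ 2 ^ (3 / 2 : ℝ) * y ^ (-(3 / 2) : ℝ) := by
      rw [Real.rpow_neg hy1.le, ← div_eq_mul_inv, one_le_div (by positivity)]
      gcongr
      linarith
    calc _ ≤ |D| * 1 := by rw [mul_one]; exact h3.trans (le_abs_self D)
      _ ≤ |D| * (2 ^ (3 / 2 : ℝ) * y ^ (-(3 / 2) : ℝ)) := by gcongr
      _ ≤ _ := by
        have : 0 ≤ 4 * (b + C) * y ^ (-(3 / 2) : ℝ) := by positivity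
        linarith
  · have hw1 : w ≠ 1 := by rintro rfl; norm_num at h
    have h3 : y / 2 ≤ ‖w‖ := le_trans (by linarith) (abs_im_le_norm w)
    have h4 : y / 2 ≤ ‖w - 1‖ := by
      refine le_trans ?_ (abs_im_le_norm _)
      simp only [sub_im, one_im, sub_zero]
      linarith
    have hX : 1 ≤ y ^ (1 / 2 : ℝ) := Real.one_le_rpow (by linarith) (by norm_num)
    have h5 : y ^ (1 / 2 : ℝ) / (y * y) = y ^ (-(3 / 2) : ℝ) := by
      rw [← sq, ← Real.rpow_natCast, ← Real.rpow_sub hy1]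
      norm_num
    rw [pickQuotient_eq hw1, norm_div, norm_mul]
    calc _ ≤ (b * y ^ (1 / 2 : ℝ) + C * y ^ (1 / 2 : ℝ)) / (y / 2 * (y / 2)) := by
          gcongr
          refine (norm_sub_le _ _).trans (add_le_add ?_ (hC w h1 h2))
          nlinarith
      _ = 4 * (b + C) * (y ^ (1 / 2 : ℝ) / (y * y)) := by field_simp; ring
      _ = 4 * (b + C) * y ^ (-(3 / 2) : ℝ) := by rw [h5]
      _ ≤ _ := by
        have : 0 ≤ |D| * 2 ^ (3 / 2 : ℝ) * y ^ (-(3 / 2) : ℝ) := by positivity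
        linarith

end riemannXi

end

section

open Complex ComplexConjugate MeasureTheory Set Filter Topology

theorem integral_two_mul_div_sq_add_sq {a : ℝ} (ha : 0 < a) :
    ∫ y : ℝ, 2 * a / (a ^ 2 + y ^ 2) = 2 * Real.pi := by
  have h1 : ∀ y : ℝ, 2 * a / (a ^ 2 + y ^ 2) = (2 / a) * (1 + (a⁻¹ * y) ^ 2)⁻¹ := by
    intro y
    field_simp
  simp_rw [h1]
  rw [integral_const_mul, Measure.integral_comp_mul_left (fun y => (1 + y ^ 2)⁻¹),
    integral_univ_inv_one_add_sq, inv_inv, abs_of_pos ha, smul_eq_mul]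
  field_simp

theorem integrable_two_mul_div_sq_add_sq {a : ℝ} (ha : 0 < a) :
    Integrable fun y : ℝ => 2 * a / (a ^ 2 + y ^ 2) := by
  have h1 : ∀ y : ℝ, 2 * a / (a ^ 2 + y ^ 2) = (2 / a) * (1 + (a⁻¹ * y) ^ 2)⁻¹ := by
    intro y
    field_simp
  simp_rw [h1]
  exact (integrable_inv_one_add_sq.comp_mul_left' (inv_ne_zero ha.ne')).const_mul _

theorem integral_cpow_mul_two_mul_div_sq_add_sq {a t : ℝ} (ha : 0 < a) (ht : 0 < t) (ht1 : t < 1) :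
    ∫ y : ℝ, (t : ℂ) ^ (-(y * I)) * ((2 * a / (a ^ 2 + y ^ 2) : ℝ) : ℂ) =
      2 * Real.pi * ((t ^ a : ℝ) : ℂ) := by
  set g : ℝ → ℂ := indicator (Ioc 0 1) (fun t => (t : ℂ) ^ (a : ℂ)) with hg
  have hgm : ∀ s : ℂ, s.re = 0 → HasMellin g s (1 / (s + a)) := fun s hs =>
    hasMellin_cpow_Ioc a (by simp [hs, ha])
  have hgi : ∀ s : ℂ, s.re = 0 → HasMellin (fun t => g t⁻¹) s (1 / (-s + a)) := by
    intro s hs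
    have h1 := hgm (-s) (by simp [hs])
    refine ⟨?_, by rw [mellin_comp_inv, h1.2]⟩
    have := (MellinConvergent.comp_rpow (f := g) (s := s) (a := -1) (by norm_num)).mpr
      (by simpa [div_neg] using h1.1)
    simpa [Real.rpow_neg_one] using this
  set h : ℝ → ℂ := fun t => g t + g t⁻¹ with hh
  have hhm : ∀ y : ℝ, mellin h (y * I) = ((2 * a / (a ^ 2 + y ^ 2) : ℝ) : ℂ) := by
    intro y
    have h0 : ((y : ℂ) * I).re = 0 := by simp
    rw [hh, (hasMellin_add (hgm _ h0).1 (hgi _ h0).1).2, (hgm _ h0).2, (hgi _ h0).2]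
    have h1 : (y : ℂ) * I + a ≠ 0 := fun h => by
      have := congrArg re h
      simp at this
      exact ha.ne' this
    have h2 : -((y : ℂ) * I) + a ≠ 0 := fun h => by
      have := congrArg re h
      simp at this
      exact ha.ne' this
    have h3 : (a : ℂ) ^ 2 + (y : ℂ) ^ 2 ≠ 0 := by
      have : a ^ 2 + y ^ 2 ≠ 0 := by positivity
      exact_mod_cast this
    push_cast
    field_simp
    linear_combination 2 * (a : ℂ) * y ^ 2 * I_sq
  have hinv := mellinInv_mellin_eq (E := ℂ) 0 h ht
    (by
      have := (hasMellin_add (hgm 0 (by simp)).1 (hgi 0 (by simp)).1).1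
      simpa using this)
    (by
      simp only [VerticalIntegrable, ofReal_zero, zero_add, hhm]
      exact (integrable_two_mul_div_sq_add_sq ha).ofReal)
    (by
      have : h =ᶠ[𝓝 t] fun u => (u : ℂ) ^ (a : ℂ) := by
        filter_upwards [Ioo_mem_nhds ht ht1] with u hu
        have h1 : u ∈ Ioc (0 : ℝ) 1 := ⟨hu.1, hu.2.le⟩
        have h2 : u⁻¹ ∉ Ioc (0 : ℝ) 1 := fun h => absurd ((one_lt_inv₀ hu.1).mpr hu.2) h.2.not_gt
        simp [hh, hg, h1, h2]
      refine ContinuousAt.congr ?_ this.symm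
      exact (continuousAt_cpow_const (by simp [ht])).comp continuous_ofReal.continuousAt)
  have h1 : t ∈ Ioc (0 : ℝ) 1 := ⟨ht, ht1.le⟩
  have h2 : t⁻¹ ∉ Ioc (0 : ℝ) 1 := fun h => absurd ((one_lt_inv₀ ht).mpr ht1) h.2.not_gt
  have h3 : h t = ((t ^ a : ℝ) : ℂ) := by
    rw [ofReal_cpow ht.le]
    simp [hh, hg, h1, h2]
  rw [h3, mellinInv] at hinv
  simp only [ofReal_zero, zero_add, hhm, smul_eq_mul] at hinv
  rw [← hinv]
  rw [real_smul]
  push_cast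
  rw [← mul_assoc, mul_one_div_cancel (by simp), one_mul]

theorem abs_add_two_mul_le_of_mellin_of_re_nonneg {Φ : ℂ → ℂ} {f : ℝ → ℝ} {b : ℝ}
    (hΦd : DifferentiableOn ℂ Φ {w | 1 / 2 < w.re})
    (hΦb : ∀ σ : ℝ, 1 / 2 < σ → ∃ C > 0, ∀ w : ℂ, σ ≤ w.re → w.re ≤ 3 / 2 →
      ‖Φ w‖ ≤ C * (1 + |w.im|) ^ (-(3 / 2) : ℝ))
    (hΦ : ∀ w : ℂ, 1 / 2 < w.re → 0 ≤ (Φ w + 2 * b / w).re)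
    (hf : ∀ y : ℝ, HasMellin (fun t => (f t : ℂ)) (1 / 2 + y * I) (Φ (3 / 2 + y * I)))
    (hf0 : ∀ t, 1 ≤ t → f t = 0) (hfc : ∀ t, 0 < t → ContinuousAt f t)
    {t : ℝ} (ht : 0 < t) (ht1 : t < 1) :
    |f t + 2 * b * t| ≤ 2 * b * √t := by
  have hmem : ∀ σ : ℝ, 1 / 2 < σ → σ ≤ 3 / 2 → Integrable fun y : ℝ => Φ (σ + y * I) := by
    intro σ h1 h2
    obtain ⟨C, -, hC⟩ := hΦb σ h1
    refine ((integrable_one_add_norm (r := 3 / 2) (by simp; norm_num)).const_mul C).mono'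
      (Continuous.aestronglyMeasurable ?_) (Eventually.of_forall fun y => ?_)
    · exact hΦd.continuousOn.comp_continuous (by fun_prop) fun y => by simpa using h1
    · simpa using hC (σ + y * I) (by simp) (by simpa)
  have hmellin : ∀ y : ℝ, mellin (fun t => (f t : ℂ)) ((1 / 2 : ℝ) + y * I) =
      Φ ((3 / 2 : ℝ) + y * I) := by
    intro y
    simpa using (hf y).2
  have hkey : ∀ a : ℝ, 1 / 2 < a → a < 1 → ∀ u : ℝ, 0 < u →
      ∫ y : ℝ, (u : ℂ) ^ (-(y * I)) * Φ (a + y * I) =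
        2 * Real.pi * ((u ^ (a - 1) * f u : ℝ) : ℂ) := by
    intro a ha ha1 u hu
    have hu0 : (u : ℂ) ≠ 0 := by simpa using hu.ne'
    have hinv := mellinInv_mellin_eq (E := ℂ) (1 / 2) (fun t => (f t : ℂ)) hu
      (by simpa using (hf 0).1)
      (by
        simp only [VerticalIntegrable, hmellin]
        exact hmem (3 / 2) (by norm_num) le_rfl)
      (continuous_ofReal.continuousAt.comp (hfc u hu))
    simp only [mellinInv, hmellin, smul_eq_mul] at hinv
    obtain ⟨C, hC0, hC⟩ := hΦb a ha
    have hshift := Complex.integral_vertical_eq_of_norm_le (f := fun w => (u : ℂ) ^ (1 - w) * Φ w)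
      (a := a) (b := 3 / 2) (C := Real.exp |Real.log u| * C) (r := 3 / 2) (by linarith)
      (by norm_num)
      (DifferentiableOn.mul (Differentiable.differentiableOn
        (Differentiable.const_cpow (by fun_prop) (Or.inl hu0)))
        (hΦd.mono fun w hw => lt_of_lt_of_le ha hw.1))
      (fun w h1 h2 => by
        rw [norm_mul, norm_cpow_eq_rpow_re_of_pos hu, mul_assoc]
        refine mul_le_mul ?_ (hC w h1 h2) (norm_nonneg _) (Real.exp_pos _).le
        rw [Real.rpow_def_of_pos hu]
        refine Real.exp_le_exp.mpr ((le_abs_self _).trans ?_)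
        rw [abs_mul]
        refine mul_le_of_le_one_right (abs_nonneg _) ?_
        rw [sub_re, one_re, abs_le]
        constructor <;> linarith)
    have h1 : ∀ y : ℝ, (u : ℂ) ^ (1 - ((a : ℂ) + y * I)) * Φ (a + y * I) =
        ((u ^ (1 - a) : ℝ) : ℂ) * ((u : ℂ) ^ (-(y * I)) * Φ (a + y * I)) := by
      intro y
      rw [ofReal_cpow hu.le, ← mul_assoc, ← cpow_add _ _ hu0]
      congr 2
      push_cast
      ring
    have h2 : ∀ y : ℝ, (u : ℂ) ^ (1 - (((3 / 2 : ℝ) : ℂ) + y * I)) * Φ ((3 / 2 : ℝ) + y * I) =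
        (u : ℂ) ^ (-(((1 / 2 : ℝ) : ℂ) + y * I)) * Φ ((3 / 2 : ℝ) + y * I) := by
      intro y
      congr 2
      push_cast
      ring
    simp only [h1, h2] at hshift
    rw [integral_const_mul] at hshift
    have h3 : (u ^ (a - 1) * u ^ (1 - a) : ℝ) = 1 := by
      rw [← Real.rpow_add hu]
      simp
    have h4 : ∫ y : ℝ, (u : ℂ) ^ (-(((1 / 2 : ℝ) : ℂ) + y * I)) * Φ ((3 / 2 : ℝ) + y * I) =
        2 * Real.pi * f u := by
      rw [← hinv, real_smul]
      push_cast
      rw [← mul_assoc, mul_one_div_cancel (by simp), one_mul]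
    rw [h4] at hshift
    calc _ = ((u ^ (a - 1) * u ^ (1 - a) : ℝ) : ℂ) *
          ∫ y : ℝ, (u : ℂ) ^ (-(y * I)) * Φ (a + y * I) := by rw [h3]; simp
      _ = _ := by
        push_cast
        rw [mul_assoc, hshift]
        ring
  have hmain : ∀ a : ℝ, 1 / 2 < a → a < 1 → |f t + 2 * b * t| ≤ 2 * b * t ^ (1 - a) := by
    intro a ha ha1
    have ha0 : 0 < a := by linarith
    have hint := hmem a ha (by linarith)
    have hintc : Integrable fun y : ℝ => conj (Φ (a + y * I)) :=
      (LinearIsometryEquiv.integrable_comp_iff conjLIE).mpr hint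
    have hintr : Integrable fun y : ℝ => (Φ (a + y * I)).re := hint.re
    have ht0 : (t : ℂ) ≠ 0 := by simpa using ht.ne'
    have hnorm : ∀ y : ℝ, ‖(t : ℂ) ^ (-(y * I))‖ = 1 := by
      intro y
      rw [norm_cpow_eq_rpow_re_of_pos ht]
      simp
    have hmeas : Continuous fun y : ℝ => (t : ℂ) ^ (-((y : ℂ) * I)) :=
      Continuous.const_cpow (by fun_prop) (Or.inl ht0)
    have hmul : ∀ g : ℝ → ℂ, Integrable g → Integrable fun y : ℝ => (t : ℂ) ^ (-(y * I)) * g y :=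
      fun g hg => hg.bdd_mul (c := 1) hmeas.aestronglyMeasurable
        (Eventually.of_forall fun y => (hnorm y).le)
    have hconj : ∫ y : ℝ, (t : ℂ) ^ (-(y * I)) * conj (Φ (a + y * I)) = 0 := by
      have h1 := congrArg conj (hkey a ha ha1 t⁻¹ (by positivity))
      rw [hf0 t⁻¹ ((one_lt_inv₀ ht).mpr ht1).le, ← integral_conj] at h1
      simp only [mul_zero, ofReal_zero, map_zero, map_mul] at h1
      rw [← h1]
      congr 1
      ext y
      congr 1
      rw [cpow_def_of_ne_zero ht0, cpow_def_of_ne_zero (show ((t⁻¹ : ℝ) : ℂ) ≠ 0 by simp [ht.ne']), ← exp_conj,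
        ← ofReal_log ht.le, ← ofReal_log (by positivity), Real.log_inv]
      simp
    have hre : ∫ y : ℝ, (t : ℂ) ^ (-(y * I)) * (((2 * (Φ (a + y * I)).re) : ℝ) : ℂ) =
        2 * Real.pi * ((t ^ (a - 1) * f t : ℝ) : ℂ) := by
      rw [← hkey a ha ha1 t ht, ← add_zero (∫ y : ℝ, (t : ℂ) ^ (-(y * I)) * Φ (a + y * I)),
        ← hconj, ← integral_add (hmul _ hint) (hmul _ hintc)]
      congr 1
      ext y
      rw [← mul_add, add_conj]
    have hR : ∀ y : ℝ, 2 * (Φ (a + y * I) + 2 * b / (a + y * I)).re =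
        2 * (Φ (a + y * I)).re + 2 * b * (2 * a / (a ^ 2 + y ^ 2)) := by
      intro y
      have h2 : (2 * (b : ℂ) / (a + y * I)).re = 2 * b * a / (a ^ 2 + y ^ 2) := by
        rw [div_re]
        simp [normSq_apply]
        ring
      rw [add_re, h2]
      ring
    have hcau := integral_cpow_mul_two_mul_div_sq_add_sq ha0 ht ht1
    have hcaui := integrable_two_mul_div_sq_add_sq ha0
    have hsum : ∫ y : ℝ, (t : ℂ) ^ (-(y * I)) *
        ((2 * (Φ (a + y * I) + 2 * b / (a + y * I)).re : ℝ) : ℂ) =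
        2 * Real.pi * ((t ^ (a - 1) * f t + 2 * b * t ^ a : ℝ) : ℂ) := by
      have h1 : ∀ y : ℝ, (t : ℂ) ^ (-(y * I)) *
          ((2 * (Φ (a + y * I) + 2 * b / (a + y * I)).re : ℝ) : ℂ) =
          (t : ℂ) ^ (-(y * I)) * (((2 * (Φ (a + y * I)).re) : ℝ) : ℂ) +
          2 * b * ((t : ℂ) ^ (-(y * I)) * ((2 * a / (a ^ 2 + y ^ 2) : ℝ) : ℂ)) := by
        intro y
        rw [hR]
        push_cast
        ring
      simp_rw [h1]
      have h2 : Integrable fun y : ℝ => (((2 * (Φ (a + y * I)).re) : ℝ) : ℂ) :=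
        (hintr.const_mul 2).ofReal
      have h3 : Integrable fun y : ℝ => ((2 * a / (a ^ 2 + y ^ 2) : ℝ) : ℂ) := hcaui.ofReal
      rw [integral_add (hmul _ h2) ((hmul _ h3).const_mul _),
        hre, integral_const_mul, hcau]
      push_cast
      ring
    have hzero : ∫ y : ℝ, (Φ (a + y * I)).re = 0 := by
      have h1 := hkey a ha ha1 1 one_pos
      simp only [ofReal_one, one_cpow, one_mul, hf0 1 le_rfl, mul_zero, ofReal_zero] at h1
      have h2 := integral_re hint
      rw [h1] at h2
      simpa using h2
    have hle : ‖∫ y : ℝ, (t : ℂ) ^ (-(y * I)) *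
        ((2 * (Φ (a + y * I) + 2 * b / (a + y * I)).re : ℝ) : ℂ)‖ ≤ 2 * b * (2 * Real.pi) := by
      refine (norm_integral_le_integral_norm _).trans_eq ?_
      have h1 : ∀ y : ℝ, ‖(t : ℂ) ^ (-(y * I)) *
          ((2 * (Φ (a + y * I) + 2 * b / (a + y * I)).re : ℝ) : ℂ)‖ =
          2 * (Φ (a + y * I)).re + 2 * b * (2 * a / (a ^ 2 + y ^ 2)) := by
        intro y
        rw [norm_mul, hnorm, one_mul, norm_real, Real.norm_of_nonneg, hR]
        have := hΦ (a + y * I) (by simpa using ha)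
        positivity
      simp_rw [h1]
      rw [integral_add (hintr.const_mul 2) (hcaui.const_mul _), integral_const_mul,
        integral_const_mul]
      rw [integral_two_mul_div_sq_add_sq ha0]
      simp [hzero]
    rw [hsum, norm_mul, norm_real] at hle
    have h5 : ‖(2 : ℂ) * Real.pi‖ = 2 * Real.pi := by
      simp [Real.pi_pos.le]
    rw [h5, mul_comm (2 * b) (2 * Real.pi)] at hle
    have h6 := le_of_mul_le_mul_left hle (by positivity)
    have h7 : f t + 2 * b * t = t ^ (1 - a) * (t ^ (a - 1) * f t + 2 * b * t ^ a) := by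
      have h8 : t ^ (1 - a) * t ^ (a - 1) = 1 := by
        rw [← Real.rpow_add ht]
        simp
      have h9 : t ^ (1 - a) * t ^ a = t := by
        rw [← Real.rpow_add ht]
        simp
      linear_combination -f t * h8 - 2 * b * h9
    rw [h7, abs_mul, abs_of_pos (by positivity), mul_comm]
    gcongr
    exact h6
  have hlim : Tendsto (fun a : ℝ => 2 * b * t ^ (1 - a)) (𝓝[>] (1 / 2)) (𝓝 (2 * b * √t)) := by
    have h1 : Continuous fun a : ℝ => 2 * b * t ^ (1 - a) :=
      continuous_const.mul (Continuous.rpow continuous_const (by fun_prop)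
        fun _ => Or.inl ht.ne')
    have h2 := (h1.tendsto (1 / 2)).mono_left (nhdsWithin_le_nhds (s := Ioi (1 / 2)))
    rw [Real.sqrt_eq_rpow]
    convert h2 using 4
    norm_num
  refine ge_of_tendsto hlim ?_
  filter_upwards [Ioo_mem_nhdsGT (show (1 / 2 : ℝ) < 1 by norm_num)] with a ha
  exact hmain a ha.1 ha.2

end

section

open Complex MeasureTheory Set Filter Topology
open scoped ENNReal

theorem hasMellin_of_hasSum_of_nonneg {F : ℕ → ℝ → ℝ} {f : ℝ → ℝ} {s : ℂ} {m : ℕ → ℂ}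
    (hF0 : ∀ n t, 0 < t → 0 ≤ F n t) (hF : ∀ n, HasMellin (fun t => (F n t : ℂ)) s (m n))
    (hm : Summable fun n => mellin (fun t => (F n t : ℂ)) s.re)
    (hf : ∀ t, 0 < t → HasSum (fun n => F n t) (f t)) :
    HasMellin (fun t => (f t : ℂ)) s (∑' n, m n) := by
  have hnorm : ∀ n, ∫ t in Ioi (0 : ℝ), ‖(t : ℂ) ^ (s - 1) • (F n t : ℂ)‖ =
      ‖mellin (fun t => (F n t : ℂ)) s.re‖ := by
    intro n
    have h1 : mellin (fun t => (F n t : ℂ)) s.re =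
        ((∫ t in Ioi (0 : ℝ), t ^ (s.re - 1) * F n t : ℝ) : ℂ) := by
      rw [mellin, ← integral_complex_ofReal]
      refine setIntegral_congr_fun measurableSet_Ioi fun t ht => ?_
      have h2 : ((s.re : ℂ) - 1) = ((s.re - 1 : ℝ) : ℂ) := by push_cast; rfl
      simp only [smul_eq_mul]
      rw [h2, ← ofReal_cpow (le_of_lt ht)]
      push_cast
      rfl
    rw [h1, norm_real, Real.norm_of_nonneg (setIntegral_nonneg measurableSet_Ioi fun t ht =>
      mul_nonneg (Real.rpow_nonneg (le_of_lt ht) _) (hF0 n t ht))]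
    refine setIntegral_congr_fun measurableSet_Ioi fun t ht => ?_
    rw [norm_smul, norm_cpow_eq_rpow_re_of_pos ht, norm_real, Real.norm_of_nonneg (hF0 n t ht)]
    simp
  have hsum : Summable fun n => ∫ t in Ioi (0 : ℝ), ‖(t : ℂ) ^ (s - 1) • (F n t : ℂ)‖ := by
    simp_rw [hnorm]
    exact hm.norm
  have hhas : ∀ t ∈ Ioi (0 : ℝ), HasSum (fun n => (t : ℂ) ^ (s - 1) • (F n t : ℂ))
      ((t : ℂ) ^ (s - 1) • (f t : ℂ)) := fun t ht =>
    (hasSum_ofReal.mpr (hf t ht)).const_smul _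
  have hint : IntegrableOn (fun t : ℝ => (t : ℂ) ^ (s - 1) • (f t : ℂ)) (Ioi 0) := by
    refine ⟨aestronglyMeasurable_of_tendsto_ae atTop
      (f := fun N (t : ℝ) => ∑ n ∈ Finset.range N, (t : ℂ) ^ (s - 1) • (F n t : ℂ))
      (fun N => Finset.aestronglyMeasurable_fun_sum _ fun n _ => (hF n).1.aestronglyMeasurable)
      ((ae_restrict_iff' measurableSet_Ioi).mpr (Eventually.of_forall fun t ht =>
        (hhas t ht).tendsto_sum_nat)), ?_⟩
    have h1 : ∫⁻ t in Ioi (0 : ℝ), ‖(t : ℂ) ^ (s - 1) • (f t : ℂ)‖ₑ ≤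
        ∑' n, ∫⁻ t in Ioi (0 : ℝ), ‖(t : ℂ) ^ (s - 1) • (F n t : ℂ)‖ₑ := by
      rw [← lintegral_tsum fun n => (hF n).1.aestronglyMeasurable.enorm]
      refine setLIntegral_mono' measurableSet_Ioi fun t ht => ?_
      rw [← (hhas t ht).tsum_eq]
      exact enorm_tsum_le_tsum_enorm
    refine h1.trans_lt ?_
    have h2 : ∀ n, ∫⁻ t in Ioi (0 : ℝ), ‖(t : ℂ) ^ (s - 1) • (F n t : ℂ)‖ₑ =
        ENNReal.ofReal (∫ t in Ioi (0 : ℝ), ‖(t : ℂ) ^ (s - 1) • (F n t : ℂ)‖) := fun n =>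
      (ofReal_integral_norm_eq_lintegral_enorm (hF n).1).symm
    simp_rw [h2]
    exact hsum.tsum_ofReal_lt_top
  refine ⟨hint, ?_⟩
  have h1 := (hasSum_integral_of_summable_integral_norm (fun n => (hF n).1) hsum).tsum_eq
  have h2 : ∀ n, ∫ t in Ioi (0 : ℝ), (t : ℂ) ^ (s - 1) • (F n t : ℂ) = m n := fun n => (hF n).2
  simp_rw [h2] at h1
  rw [h1, mellin]
  exact setIntegral_congr_fun measurableSet_Ioi fun t ht => ((hhas t ht).tsum_eq).symm

theorem HasMellin.congr {f g : ℝ → ℂ} {s m : ℂ} (hf : HasMellin f s m)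
    (h : ∀ t, 0 < t → f t = g t) : HasMellin g s m := by
  refine ⟨?_, ?_⟩
  · exact (integrableOn_congr_fun (fun t ht => by simp only [h t ht]) measurableSet_Ioi).mp hf.1
  · rw [← hf.2]
    exact setIntegral_congr_fun measurableSet_Ioi fun t ht => by simp only [h t ht]

theorem HasMellin.add {f g : ℝ → ℂ} {s m n : ℂ} (hf : HasMellin f s m) (hg : HasMellin g s n) :
    HasMellin (fun t => f t + g t) s (m + n) := by
  rw [← hf.2, ← hg.2]
  exact hasMellin_add hf.1 hg.1

theorem HasMellin.const_mul {f : ℝ → ℂ} {s m : ℂ} (hf : HasMellin f s m) (c : ℂ) :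
    HasMellin (fun t => c * f t) s (c * m) := by
  rw [← hf.2]
  exact hasMellin_const_smul hf.1 c

theorem hasMellin_pow_Ioc (k : ℕ) {s : ℂ} (hs : 0 < s.re) :
    HasMellin (indicator (Ioc 0 1) fun t : ℝ => (t : ℂ) ^ k) s (1 / (s + k)) := by
  have := hasMellin_cpow_Ioc (k : ℂ) (s := s) (by simp; positivity)
  simpa only [cpow_natCast] using this

theorem hasMellin_log_Ioc {s : ℂ} (hs : 0 < s.re) :
    HasMellin (indicator (Ioc 0 1) fun t : ℝ => (Real.log t : ℂ)) s (-1 / s ^ 2) := by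
  set f : ℝ → ℂ := indicator (Ioc 0 1) fun _ => 1 with hf
  have h := mellin_hasDerivAt_of_isBigO_rpow (f := f) (s := s) (a := s.re + 1) (b := 0)
    (((locallyIntegrable_const (1 : ℂ)).indicator measurableSet_Ioc).locallyIntegrableOn _)
    (by
      refine Asymptotics.IsBigO.congr' (Asymptotics.isBigO_zero _ _) ?_ EventuallyEq.rfl
      filter_upwards [eventually_gt_atTop 1] with t ht
      simp [hf, ht])
    (by linarith)
    (by
      simp only [neg_zero, Real.rpow_zero]
      refine Asymptotics.isBigO_of_le _ fun t => ?_
      simp only [hf, indicator]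
      split_ifs <;> simp)
    hs
  have h1 : HasDerivAt (mellin f) (-1 / s ^ 2) s := by
    have h2 : HasDerivAt (fun z : ℂ => 1 / z) (-1 / s ^ 2) s := by
      have hs0 : s ≠ 0 := fun h => by simp [h] at hs
      simpa [neg_div] using hasDerivAt_inv hs0
    refine h2.congr_of_eventuallyEq ?_
    filter_upwards [(isOpen_lt continuous_const continuous_re).mem_nhds hs] with z hz
    exact (hasMellin_one_Ioc hz).2
  refine HasMellin.congr (f := fun t => Real.log t • f t) ⟨h.1, h.2.unique h1⟩ fun t _ => ?_
  by_cases ht : t ∈ Ioc (0 : ℝ) 1 <;> simp [hf, ht]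

theorem hasMellin_max_inv_sub_zero {n : ℕ} (hn : n ≠ 0) {s : ℂ} (hs : 0 < s.re) :
    HasMellin (fun t : ℝ => ((max ((n : ℝ)⁻¹ - t) 0 : ℝ) : ℂ)) s
      (1 / (n : ℂ) ^ (s + 1) * (1 / (s * (s + 1)))) := by
  have hn0 : 0 < (n : ℝ) := by positivity
  have hnc : (n : ℂ) ≠ 0 := by exact_mod_cast hn
  have hs0 : s ≠ 0 := fun h => by simp [h] at hs
  have hs1 : s + 1 ≠ 0 := fun h => by
    have := congrArg re h
    simp at this
    linarith
  set g : ℝ → ℂ := fun t => indicator (Ioc 0 1) (fun _ => 1) t +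
    (-1) * indicator (Ioc 0 1) (fun t : ℝ => (t : ℂ) ^ 1) t with hg
  have h1 : HasMellin g s (1 / (s * (s + 1))) := by
    have := (hasMellin_one_Ioc hs).add ((hasMellin_pow_Ioc 1 hs).const_mul (-1))
    convert this using 1
    push_cast
    field_simp
    ring
  have h2 : HasMellin (fun t => (n : ℂ)⁻¹ * g (n * t)) s
      ((n : ℂ)⁻¹ * ((n : ℂ) ^ (-s) * (1 / (s * (s + 1))))) := by
    refine HasMellin.const_mul ⟨(MellinConvergent.comp_mul_left hn0).mpr h1.1, ?_⟩ _
    rw [mellin_comp_mul_left _ _ hn0, h1.2, smul_eq_mul]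
    simp
  have h3 : (n : ℂ)⁻¹ * ((n : ℂ) ^ (-s) * (1 / (s * (s + 1)))) =
      1 / (n : ℂ) ^ (s + 1) * (1 / (s * (s + 1))) := by
    rw [cpow_neg, cpow_add _ _ hnc, cpow_one, one_div ((n : ℂ) ^ s * n), mul_inv]
    ring
  rw [h3] at h2
  refine h2.congr fun t ht => ?_
  by_cases h4 : (n : ℝ) * t ≤ 1
  · have h5 : (n : ℝ) * t ∈ Ioc (0 : ℝ) 1 := ⟨by positivity, h4⟩
    have h6 : 0 ≤ (n : ℝ)⁻¹ - t := by
      rw [sub_nonneg, le_inv_comm₀ ht hn0, ← one_div, le_div_iff₀ ht]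
      exact h4
    rw [max_eq_left h6]
    simp only [hg, indicator_of_mem h5]
    push_cast
    field_simp
    ring
  · have h5 : (n : ℝ) * t ∉ Ioc (0 : ℝ) 1 := fun h => h4 h.2
    have h6 : (n : ℝ)⁻¹ - t ≤ 0 := by
      rw [sub_nonpos, inv_le_comm₀ hn0 ht, ← one_div, div_le_iff₀ ht]
      exact (not_le.mp h4).le
    rw [max_eq_right h6]
    simp [hg, indicator_of_notMem h5]

end

section

open Complex MeasureTheory Set Filter Topology

theorem summable_inv_even_mul_odd :
    Summable fun n : ℕ => 1 / ((2 * ((n : ℝ) + 1)) * (2 * ((n : ℝ) + 1) + 1)) := by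
  have h := (summable_nat_add_iff 1).mpr (Real.summable_one_div_nat_pow.mpr one_lt_two)
  refine Summable.of_nonneg_of_le (fun n => by positivity) (fun n => ?_) h
  push_cast
  gcongr
  nlinarith [n.cast_nonneg (α := ℝ)]

theorem tsum_inv_even_mul_odd :
    ∑' n : ℕ, 1 / ((2 * ((n : ℝ) + 1)) * (2 * ((n : ℝ) + 1) + 1)) = 1 - Real.log 2 := by
  have h := Complex.hasSum_digamma_add_one (s := 1 / 2) (by norm_num)
  have hm : ∀ m : ℕ, (1 / 2 : ℂ) ≠ -m := fun m h => by
    have := congrArg re h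
    norm_num at this
    linarith [m.cast_nonneg (α := ℝ)]
  rw [digamma_apply_add_one _ hm, digamma_one_half] at h
  have h2 := h.div_const 2
  have h3 : ∀ n : ℕ, (1 / 2 : ℂ) / ((n + 1) * (n + 1 + 1 / 2)) / 2 =
      ((1 / ((2 * ((n : ℝ) + 1)) * (2 * ((n : ℝ) + 1) + 1)) : ℝ) : ℂ) := by
    intro n
    have h4 : ((n : ℂ) + 1) ≠ 0 := by exact_mod_cast n.succ_ne_zero
    have h5 : (2 * ((n : ℂ) + 1) + 1) ≠ 0 := by exact_mod_cast (2 * (n + 1)).succ_ne_zero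
    have h6 : ((n : ℂ) + 1 + 1 / 2) = (2 * ((n : ℂ) + 1) + 1) / 2 := by ring
    push_cast
    rw [h6]
    field_simp
  simp_rw [h3] at h2
  have h4 : (-2 * Complex.log 2 - (Real.eulerMascheroniConstant : ℂ) + (1 / 2 : ℂ)⁻¹ +
      Real.eulerMascheroniConstant) / 2 = ((1 - Real.log 2 : ℝ) : ℂ) := by
    have h5 : Complex.log 2 = (Real.log 2 : ℂ) := by simp
    rw [h5]
    push_cast
    ring
  rw [h4] at h2
  exact (hasSum_ofReal.mp h2).tsum_eq

/-- The sum `∑ (Λ n / n) * (1 - n * t)` over `n ≤ 1 / t`. -/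
noncomputable def smoothedVonMangoldtSum (t : ℝ) : ℝ := ∑' n : ℕ, Λ n * max ((n : ℝ)⁻¹ - t) 0

theorem hasSum_smoothedVonMangoldtSum {t : ℝ} {N : ℕ} (ht : 0 < t) (hN : t⁻¹ ≤ N) :
    smoothedVonMangoldtSum t = ∑ n ∈ Finset.range (N + 1), Λ n * max ((n : ℝ)⁻¹ - t) 0 ∧
    HasSum (fun n : ℕ => Λ n * max ((n : ℝ)⁻¹ - t) 0) (smoothedVonMangoldtSum t) := by
  have h : ∀ n ∉ Finset.range (N + 1), Λ n * max ((n : ℝ)⁻¹ - t) 0 = 0 := by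
    intro n hn
    rw [Finset.mem_range, not_lt] at hn
    have hn' : (N : ℝ) + 1 ≤ n := by exact_mod_cast hn
    have h1 : (n : ℝ)⁻¹ ≤ t := inv_le_of_inv_le₀ ht (by linarith)
    rw [max_eq_right (by linarith), mul_zero]
  have h2 : HasSum (fun n : ℕ => Λ n * max ((n : ℝ)⁻¹ - t) 0) _ := hasSum_sum_of_ne_finset_zero h
  exact ⟨h2.tsum_eq, h2.summable.hasSum⟩

theorem smoothedVonMangoldtSum_inv {x : ℝ} (hx : 0 < x) : smoothedVonMangoldtSum x⁻¹ =
    ∑ n ∈ Finset.Icc 1 ⌊x⌋₊, (Λ n / n) * (1 - n / x) := by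
  have h : ∀ n ∉ Finset.Icc 1 ⌊x⌋₊, Λ n * max ((n : ℝ)⁻¹ - x⁻¹) 0 = 0 := by
    intro n hn
    rcases Nat.eq_zero_or_pos n with rfl | hn0
    · simp
    · have h1 : ⌊x⌋₊ < n := by
        by_contra! h
        exact hn (Finset.mem_Icc.mpr ⟨hn0, h⟩)
      have h2 : x < n := (Nat.floor_lt hx.le).mp h1
      have h3 : (n : ℝ)⁻¹ ≤ x⁻¹ := inv_anti₀ hx h2.le
      rw [max_eq_right (by linarith), mul_zero]
  rw [smoothedVonMangoldtSum, tsum_eq_sum h]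
  refine Finset.sum_congr rfl fun n hn => ?_
  obtain ⟨h1, h2⟩ := Finset.mem_Icc.mp hn
  have h3 : (n : ℝ) ≤ x := (Nat.le_floor_iff hx.le).mp h2
  have h4 : (0 : ℝ) < n := by exact_mod_cast h1
  have h5 : x⁻¹ ≤ (n : ℝ)⁻¹ := inv_anti₀ h4 h3
  rw [max_eq_left (by linarith)]
  field_simp

theorem smoothedVonMangoldtSum_eq_zero {t : ℝ} (ht : 1 ≤ t) : smoothedVonMangoldtSum t = 0 := by
  rw [(hasSum_smoothedVonMangoldtSum (N := 1) (by linarith)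
    (by simpa using inv_le_one_of_one_le₀ ht)).1]
  simp [Finset.sum_range_succ]

theorem continuousAt_smoothedVonMangoldtSum {t : ℝ} (ht : 0 < t) :
    ContinuousAt smoothedVonMangoldtSum t := by
  obtain ⟨N, hN⟩ := exists_nat_ge (t / 2)⁻¹
  have h : smoothedVonMangoldtSum =ᶠ[𝓝 t]
      fun u => ∑ n ∈ Finset.range (N + 1), Λ n * max ((n : ℝ)⁻¹ - u) 0 := by
    filter_upwards [lt_mem_nhds (half_lt_self ht)] with u hu
    have h1 : u⁻¹ ≤ (t / 2)⁻¹ := inv_anti₀ (by positivity) hu.le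
    exact (hasSum_smoothedVonMangoldtSum (lt_trans (by positivity) hu) (h1.trans hN)).1
  refine ContinuousAt.congr (Continuous.continuousAt ?_) h.symm
  fun_prop

theorem hasMellin_smoothedVonMangoldtSum {s : ℂ} (hs : 0 < s.re) :
    HasMellin (fun t => (smoothedVonMangoldtSum t : ℂ)) s
      (-(deriv riemannZeta (s + 1) / riemannZeta (s + 1)) * (1 / (s * (s + 1)))) := by
  have hterm : ∀ s : ℂ, 0 < s.re → ∀ n : ℕ,
      HasMellin (fun t : ℝ => ((Λ n * max ((n : ℝ)⁻¹ - t) 0 : ℝ) : ℂ)) s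
        (LSeries.term (fun n => (Λ n : ℂ)) (s + 1) n * (1 / (s * (s + 1)))) := by
    intro s hs n
    rcases eq_or_ne n 0 with rfl | hn
    · simp [HasMellin, MellinConvergent, mellin]
    · rw [LSeries.term_of_ne_zero hn]
      have := (hasMellin_max_inv_sub_zero hn hs).const_mul (Λ n : ℂ)
      rw [← mul_assoc, mul_one_div (Λ n : ℂ)] at this
      exact this.congr fun t _ => by push_cast; rfl
  have hsummable : ∀ s : ℂ, 0 < s.re → Summable fun n : ℕ =>
      LSeries.term (fun n => (Λ n : ℂ)) (s + 1) n * (1 / (s * (s + 1))) := fun s hs =>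
    Summable.mul_right _ (ArithmeticFunction.LSeriesSummable_vonMangoldt (s := s + 1) (by simpa))
  have h := hasMellin_of_hasSum_of_nonneg (f := smoothedVonMangoldtSum)
    (F := fun n t => Λ n * max ((n : ℝ)⁻¹ - t) 0)
    (fun n t _ => mul_nonneg ArithmeticFunction.vonMangoldt_nonneg (le_max_right _ _))
    (hterm s hs)
    (by
      simp_rw [fun n => (hterm s.re (by simpa) n).2]
      exact hsummable _ (by simpa))
    (fun t ht => by
      obtain ⟨N, hN⟩ := exists_nat_ge t⁻¹
      exact (hasSum_smoothedVonMangoldtSum ht hN).2)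
  have h2 := ArithmeticFunction.LSeries_vonMangoldt_eq_deriv_riemannZeta_div (s := s + 1) (by simpa)
  rw [tsum_mul_right] at h
  rw [← neg_div, ← h2]
  exact h

/-- The series `∑ t ^ (2 * k + 1) / (2 * k * (2 * k + 1))` over `k ≥ 1`. -/
noncomputable def trivialZeroSum (t : ℝ) : ℝ :=
  ∑' n : ℕ, t ^ (2 * (n + 1) + 1) / ((2 * ((n : ℝ) + 1)) * (2 * ((n : ℝ) + 1) + 1))

theorem norm_trivialZeroSum_term_le {t : ℝ} (ht : t ∈ Icc (0 : ℝ) 1) (n : ℕ) :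
    ‖t ^ (2 * (n + 1) + 1) / ((2 * ((n : ℝ) + 1)) * (2 * ((n : ℝ) + 1) + 1))‖ ≤
      1 / ((2 * ((n : ℝ) + 1)) * (2 * ((n : ℝ) + 1) + 1)) := by
  have := ht.1
  rw [Real.norm_of_nonneg (by positivity)]
  gcongr
  exact pow_le_one₀ ht.1 ht.2

theorem continuousOn_trivialZeroSum : ContinuousOn trivialZeroSum (Icc 0 1) :=
  continuousOn_tsum (fun n => by fun_prop) summable_inv_even_mul_odd
    fun n _ ht => norm_trivialZeroSum_term_le ht n

theorem trivialZeroSum_one : trivialZeroSum 1 = 1 - Real.log 2 := by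
  simp [trivialZeroSum, ← tsum_inv_even_mul_odd]

theorem hasMellin_trivialZeroSum {s : ℂ} (hs : 0 < s.re) :
    HasMellin (fun t => (((Ioc 0 1).indicator trivialZeroSum t : ℝ) : ℂ)) s
      (∑' n : ℕ, 1 / ((2 * ((n : ℂ) + 1)) * (2 * ((n : ℂ) + 1) + 1)) *
        (1 / (s + (2 * (n + 1) + 1)))) := by
  have hterm : ∀ s : ℂ, 0 < s.re → ∀ n : ℕ,
      HasMellin (fun t : ℝ => (((Ioc 0 1).indicator (fun t => t ^ (2 * (n + 1) + 1) /
        ((2 * ((n : ℝ) + 1)) * (2 * ((n : ℝ) + 1) + 1))) t : ℝ) : ℂ)) s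
        (1 / ((2 * ((n : ℂ) + 1)) * (2 * ((n : ℂ) + 1) + 1)) *
        (1 / (s + (2 * (n + 1) + 1)))) := by
    intro s hs n
    have h := (hasMellin_pow_Ioc (2 * (n + 1) + 1) hs).const_mul
      (1 / ((2 * ((n : ℂ) + 1)) * (2 * ((n : ℂ) + 1) + 1)))
    convert h.congr fun t _ => ?_ using 1
    · push_cast
      rfl
    · by_cases ht : t ∈ Ioc (0 : ℝ) 1 <;> simp [ht]
      field_simp
  refine hasMellin_of_hasSum_of_nonneg
    (F := fun n => (Ioc 0 1).indicator fun t => t ^ (2 * (n + 1) + 1) /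
        ((2 * ((n : ℝ) + 1)) * (2 * ((n : ℝ) + 1) + 1)))
    (fun n t ht => indicator_nonneg (fun u hu => ?_) t) (hterm s hs) ?_ fun t ht => ?_
  · have := hu.1
    positivity
  · simp_rw [fun n => (hterm s.re (by simpa) n).2]
    refine Summable.of_norm_bounded summable_inv_even_mul_odd fun n => ?_
    rw [norm_mul]
    have h1 : ‖(1 : ℂ) / ((2 * ((n : ℂ) + 1)) * (2 * ((n : ℂ) + 1) + 1))‖ =
        1 / ((2 * ((n : ℝ) + 1)) * (2 * ((n : ℝ) + 1) + 1)) := by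
      rw [show (1 : ℂ) / ((2 * ((n : ℂ) + 1)) * (2 * ((n : ℂ) + 1) + 1)) =
        ((1 / ((2 * ((n : ℝ) + 1)) * (2 * ((n : ℝ) + 1) + 1)) : ℝ) : ℂ) by push_cast; rfl,
        norm_real, Real.norm_of_nonneg (by positivity)]
    have h2 : ‖(1 : ℂ) / ((s.re : ℂ) + (2 * (n + 1) + 1))‖ ≤ 1 := by
      rw [show (1 : ℂ) / ((s.re : ℂ) + (2 * (n + 1) + 1)) =
        ((1 / (s.re + (2 * (n + 1) + 1)) : ℝ) : ℂ) by push_cast; rfl,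
        norm_real, Real.norm_of_nonneg (by positivity), div_le_one (by positivity)]
      linarith [n.cast_nonneg (α := ℝ)]
    rw [h1]
    exact mul_le_of_le_one_right (by positivity) h2
  · by_cases h : t ∈ Ioc (0 : ℝ) 1
    · simp only [indicator_of_mem h]
      exact (Summable.of_norm_bounded summable_inv_even_mul_odd
        fun n => norm_trivialZeroSum_term_le ⟨h.1.le, h.2⟩ n).hasSum
    · simp [indicator_of_notMem h]

end

section

open Complex MeasureTheory Set Filter Topology

theorem re_pickQuotient_add_nonneg
    (RH : ∀ s : ℂ, riemannZeta s = 0 → 0 < s.re → s.re < 1 → s.re = 1 / 2)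
    {b : ℝ} (hb : completedRiemannZeta₀ 1 = b) {w : ℂ} (hw : 1 / 2 < w.re) :
    0 ≤ (riemannXi.pickQuotient w + 2 * b / w).re := by
  have hw0 : w ≠ 0 := fun h => by norm_num [h] at hw
  have h : ∀ z : ℂ, 1 / 2 < z.re → z ≠ 1 →
      0 ≤ (riemannXi.pickQuotient z + 2 * b / z).re := by
    intro z hz hz1
    have hz0 : z ≠ 0 := fun h => by norm_num [h] at hz
    have hz2 : z - 1 ≠ 0 := sub_ne_zero.mpr hz1
    convert riemannXi.re_pick_nonneg RH hb hz using 2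
    rw [riemannXi.pickQuotient_eq hz1, hb]
    field_simp
    ring
  rcases eq_or_ne w 1 with rfl | hw1
  · have hopen : {z : ℂ | 1 / 2 < z.re} ∈ 𝓝 (1 : ℂ) :=
      (isOpen_lt continuous_const continuous_re).mem_nhds (by norm_num)
    have hcont : ContinuousAt (fun z : ℂ => (riemannXi.pickQuotient z + 2 * b / z).re) 1 :=
      continuous_re.continuousAt.comp
        (((riemannXi.differentiableOn_pickQuotient RH).differentiableAt hopen).continuousAt.add
          (continuousAt_const.div continuousAt_id one_ne_zero))
    refine ge_of_tendsto (hcont.tendsto.mono_left (nhdsWithin_le_nhds (s := {1}ᶜ))) ?_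
    filter_upwards [nhdsWithin_le_nhds hopen, self_mem_nhdsWithin] with z h1 h2
    exact h z h1 h2
  · exact h w hw hw1

/-- The elementary part of the error term in the explicit formula at `1 / t`, less `2 * b * t`. -/
noncomputable def explicitFormulaRemainder (b t : ℝ) : ℝ :=
  Real.log t + (1 + Real.eulerMascheroniConstant) - (Real.log (2 * Real.pi) + 2 * b) * t +
    trivialZeroSum t

theorem eq_of_completedRiemannZeta₀_one_eq {b : ℝ} (hb : completedRiemannZeta₀ 1 = b) :
    b = (Real.eulerMascheroniConstant - Real.log (4 * Real.pi)) / 2 + 1 := by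
  rw [completedRiemannZeta₀_one] at hb
  have h : Complex.log (4 * Real.pi) = (Real.log (4 * Real.pi) : ℂ) := by
    rw [ofReal_log (by positivity)]
    push_cast
    rfl
  rw [h] at hb
  exact_mod_cast hb.symm

theorem explicitFormulaRemainder_one {b : ℝ} (hb : completedRiemannZeta₀ 1 = b) :
    explicitFormulaRemainder b 1 = 0 := by
  have h1 := eq_of_completedRiemannZeta₀_one_eq hb
  have h2 : Real.log (4 * Real.pi) = Real.log 2 + Real.log (2 * Real.pi) := by
    rw [← Real.log_mul (by norm_num) (by positivity)]
    ring_nf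
  rw [explicitFormulaRemainder, trivialZeroSum_one, h1, h2, Real.log_one]
  ring

theorem continuousOn_explicitFormulaRemainder (b : ℝ) :
    ContinuousOn (explicitFormulaRemainder b) (Ioc 0 1) := by
  refine ContinuousOn.add (ContinuousOn.sub (ContinuousOn.add
    (Real.continuousOn_log.mono fun t ht => ht.1.ne') continuousOn_const) (by fun_prop))
    (continuousOn_trivialZeroSum.mono Ioc_subset_Icc_self)

theorem hasMellin_explicitFormulaRemainder (b : ℝ) {s : ℂ} (hs : 0 < s.re) :
    HasMellin (fun t => (((Ioc 0 1).indicator (explicitFormulaRemainder b) t : ℝ) : ℂ)) s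
      (-1 / s ^ 2 + (1 + Real.eulerMascheroniConstant) * (1 / s) +
        -(Real.log (2 * Real.pi) + 2 * b) * (1 / (s + 1)) +
      ∑' n : ℕ, 1 / ((2 * ((n : ℂ) + 1)) * (2 * ((n : ℂ) + 1) + 1)) *
        (1 / (s + (2 * (n + 1) + 1)))) := by
  have h1 := hasMellin_pow_Ioc 1 hs
  rw [Nat.cast_one] at h1
  have h := (((hasMellin_log_Ioc hs).add ((hasMellin_one_Ioc hs).const_mul
    (1 + Real.eulerMascheroniConstant))).add
    (h1.const_mul (-(Real.log (2 * Real.pi) + 2 * b)))).add (hasMellin_trivialZeroSum hs)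
  refine h.congr fun t _ => ?_
  by_cases ht : t ∈ Ioc (0 : ℝ) 1
  · simp only [indicator_of_mem ht, explicitFormulaRemainder]
    push_cast
    ring
  · simp [indicator_of_notMem ht]

theorem tsum_trivialZero_mul {s : ℂ} (hs : 0 < s.re) :
    s * (s + 1) * ∑' n : ℕ, 1 / ((2 * ((n : ℂ) + 1)) * (2 * ((n : ℂ) + 1) + 1)) *
        (1 / (s + (2 * (n + 1) + 1))) =
      (s + 1) * (1 - Real.log 2) -
        ∑' n : ℕ, (s + 1) / ((2 * ((n : ℂ) + 1)) * (s + 1 + 2 * (n + 1))) := by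
  have h1 : HasSum (fun n : ℕ => 1 / ((2 * ((n : ℂ) + 1)) * (2 * ((n : ℂ) + 1) + 1)))
      (1 - Real.log 2) := by
    have := hasSum_ofReal.mpr summable_inv_even_mul_odd.hasSum
    rw [tsum_inv_even_mul_odd] at this
    convert this using 1
    · ext n
      push_cast
      rfl
    · push_cast
      rfl
  have h2 : Summable fun n : ℕ => (s + 1) / ((2 * ((n : ℂ) + 1)) * (s + 1 + 2 * (n + 1))) := by
    have h3 := (Complex.hasSum_digamma_add_one (s := (s + 1) / 2) (by simp; linarith)).summable
    refine (h3.div_const 2).congr fun n => ?_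
    have h4 : (n : ℂ) + 1 + (s + 1) / 2 = (s + 1 + 2 * (n + 1)) / 2 := by ring
    rw [h4]
    field_simp
  rw [← tsum_mul_left, ← (h1.mul_left (s + 1)).tsum_eq,
    ← (h1.mul_left (s + 1)).summable.tsum_sub h2]
  congr 1
  ext n
  have h4 : (n : ℂ) + 1 ≠ 0 := by exact_mod_cast n.succ_ne_zero
  have h5 : 2 * ((n : ℂ) + 1) + 1 ≠ 0 := by exact_mod_cast (2 * (n + 1)).succ_ne_zero
  have h6 : s + (2 * ((n : ℂ) + 1) + 1) ≠ 0 := fun h => by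
    have := congrArg re h
    simp at this
    linarith [n.cast_nonneg (α := ℝ)]
  have h7 : s + 1 + 2 * ((n : ℂ) + 1) ≠ 0 := by
    convert h6 using 1
    ring
  field_simp
  ring

theorem hasMellin_pickQuotient {b : ℝ} (hb : completedRiemannZeta₀ 1 = b) {s : ℂ} (hs : 0 < s.re) :
    HasMellin (fun t => ((smoothedVonMangoldtSum t + explicitFormulaRemainder b (min t 1) : ℝ) : ℂ))
      s (riemannXi.pickQuotient (s + 1)) := by
  have h := (hasMellin_smoothedVonMangoldtSum hs).add (hasMellin_explicitFormulaRemainder b hs)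
  have hs0 : s ≠ 0 := fun h => by simp [h] at hs
  have hs1 : s + 1 ≠ 0 := fun h => by
    have := congrArg re h
    simp at this
    linarith
  convert h.congr fun t ht => ?_ using 1
  · rw [riemannXi.pickQuotient_eq (by simpa using hs0), riemannXi.logDeriv_eq (by simpa), hb]
    have h1 := tsum_trivialZero_mul hs
    have h2 : (b : ℂ) =
        (Real.eulerMascheroniConstant - Real.log (2 * Real.pi) - Real.log 2) / 2 + 1 := by
      have h3 : Real.log (4 * Real.pi) = Real.log 2 + Real.log (2 * Real.pi) := by
        rw [← Real.log_mul (by norm_num) (by positivity)]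
        ring_nf
      rw [eq_of_completedRiemannZeta₀_one_eq hb, h3]
      push_cast
      ring
    have h3 : (Real.log Real.pi : ℂ) = Real.log (2 * Real.pi) - Real.log 2 := by
      rw [Real.log_mul (by norm_num) (by positivity)]
      push_cast
      ring
    rw [add_sub_cancel_right, h2, h3]
    rw [eq_div_of_mul_eq (mul_ne_zero hs0 hs1) ((mul_comm _ _).trans h1)]
    generalize (∑' n : ℕ, (s + 1) / ((2 * ((n : ℂ) + 1)) * (s + 1 + 2 * (n + 1)))) = T
    generalize deriv riemannZeta (s + 1) / riemannZeta (s + 1) = Q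
    field_simp
    ring
  · rw [← ofReal_add]
    congr 2
    by_cases ht1 : t ≤ 1
    · rw [min_eq_left ht1, indicator_of_mem (show t ∈ Ioc (0 : ℝ) 1 from ⟨ht, ht1⟩)]
    · rw [min_eq_right (not_le.mp ht1).le, explicitFormulaRemainder_one hb,
        indicator_of_notMem fun h => ht1 h.2]

theorem abs_explicitFormula_le
    (RH : ∀ s : ℂ, riemannZeta s = 0 → 0 < s.re → s.re < 1 → s.re = 1 / 2)
    {b : ℝ} (hb : completedRiemannZeta₀ 1 = b) {t : ℝ} (ht : 0 < t) (ht1 : t < 1) :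
    |smoothedVonMangoldtSum t + explicitFormulaRemainder b t + 2 * b * t| ≤ 2 * b * √t := by
  have h := abs_add_two_mul_le_of_mellin_of_re_nonneg
    (f := fun t => smoothedVonMangoldtSum t + explicitFormulaRemainder b (min t 1))
    (riemannXi.differentiableOn_pickQuotient RH)
    (fun σ hσ => riemannXi.exists_bound_pickQuotient RH hσ)
    (fun w hw => re_pickQuotient_add_nonneg RH hb hw)
    (fun y => by
      convert hasMellin_pickQuotient hb (s := 1 / 2 + y * I) (by norm_num) using 2
      ring)
    (fun u hu => by
      rw [smoothedVonMangoldtSum_eq_zero hu, min_eq_right hu, explicitFormulaRemainder_one hb,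
        add_zero])
    (fun u hu => by
      refine (continuousAt_smoothedVonMangoldtSum hu).add ?_
      have h1 : ContinuousOn (fun u => explicitFormulaRemainder b (min u 1)) (Ioi 0) :=
        (continuousOn_explicitFormulaRemainder b).comp (by fun_prop) fun u hu =>
          ⟨lt_min hu one_pos, min_le_right _ _⟩
      exact h1.continuousAt (Ioi_mem_nhds hu))
    ht ht1
  simpa only [min_eq_left ht1.le] using h

theorem trivialZeroSum_inv {x : ℝ} (hx : 0 < x) : trivialZeroSum x⁻¹ =
    ∑' n : ℕ, x ^ (-2 * ((n : ℝ) + 1) - 1) /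
      ((2 * ((n : ℝ) + 1)) * (2 * ((n : ℝ) + 1) + 1)) := by
  rw [trivialZeroSum]
  congr 1
  ext n
  congr 1
  rw [inv_pow, ← Real.rpow_natCast, ← Real.rpow_neg hx.le]
  push_cast
  ring_nf

end

/-- Lemma 3.5 (Lamzouri–Li–Soundararajan, Lemma 2.4): assuming RH, with
`B = (1/2)log(4π) − 1 − γ/2`, for every real `x > 1`,
`|∑_{n ≤ x} (Λ(n)/n)(1 − n/x) − (log x − (1+γ) + log(2π)/x − ∑_{n≥1} x^{−2n−1}/(2n(2n+1)))|
  ≤ 2|B|/√x`. -/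
theorem stmt_14
    (RH : ∀ s : ℂ, riemannZeta s = 0 → 0 < s.re → s.re < 1 → s.re = 1 / 2)
    (B : ℝ)
    (hB : B = (1 / 2) * Real.log (4 * Real.pi) - 1 - Real.eulerMascheroniConstant / 2)
    (x : ℝ) (hx : 1 < x) :
    |(∑ n ∈ Finset.Icc 1 ⌊x⌋₊, (Λ n / n) * (1 - n / x))
        - (Real.log x - (1 + Real.eulerMascheroniConstant)
            + Real.log (2 * Real.pi) / x
            - ∑' n : ℕ, x ^ (-2 * ((n : ℝ) + 1) - 1) /
                ((2 * ((n : ℝ) + 1)) * (2 * ((n : ℝ) + 1) + 1)))|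
      ≤ 2 * |B| / Real.sqrt x := by
  have hx0 : 0 < x := by linarith
  have hb : completedRiemannZeta₀ 1 = ((-B : ℝ) : ℂ) := by
    have h : Complex.log (4 * Real.pi) = (Real.log (4 * Real.pi) : ℂ) := by
      rw [Complex.ofReal_log (by positivity)]
      push_cast
      rfl
    rw [completedRiemannZeta₀_one, h, hB]
    push_cast
    ring
  have h := abs_explicitFormula_le RH hb (inv_pos.mpr hx0) (inv_lt_one_of_one_lt₀ hx)
  rw [← smoothedVonMangoldtSum_inv hx0, ← trivialZeroSum_inv hx0]
  calc _ = |smoothedVonMangoldtSum x⁻¹ + explicitFormulaRemainder (-B) x⁻¹ + 2 * -B * x⁻¹| := by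
        rw [explicitFormulaRemainder, Real.log_inv]
        congr 1
        ring
    _ ≤ 2 * -B * √x⁻¹ := h
    _ ≤ 2 * |B| * √x⁻¹ := by
        gcongr
        exact neg_le_abs B
    _ = 2 * |B| / √x := by rw [Real.sqrt_inv, div_eq_mul_inv]
end
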